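/- arXiv:2411.04084 — 6 statements merged into one kernel-verified Lean document; each statement's English description precedes it below -/
import Mathlib

section
/- (Theorem 1.1(iv) on ℍ³.) Let α > 3/2 and let q ∈ [1, ∞]. Then for every R > 0 there is a constant C > 0 (depending only on α, q and R) such that ‖S*g‖_{L^q(B_R)} ≤ C ‖g‖_{H^α} for all even Schwartz functions g : ℝ → ℂ. -/
open MeasureTheory Filter Set ENNReal

noncomputable section

/-- The Schrödinger propagator on `ℍ³` applied to an even Schwartz function `g`
(the spherical Fourier transform of the radial initial data). -/
def Sprop (g : ℝ → ℂ) (t s : ℝ) : ℂ :=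
  ∫ l in Set.Ioi (0 : ℝ),
    ((Real.sin (l * s) / (l * Real.sinh s) : ℝ) : ℂ)
      * Complex.exp (Complex.I * ((t * (l ^ 2 + 1) : ℝ) : ℂ))
      * g l * ((l : ℂ) ^ 2)

/-- The Schrödinger maximal function `S* g (s) = sup_{0<t<1} |S_t g (s)|`. -/
def Sstar (g : ℝ → ℂ) (s : ℝ) : ℝ :=
  ⨆ t : Set.Ioo (0 : ℝ) 1, ‖Sprop g (t : ℝ) s‖

/-- The fractional Sobolev norm `‖g‖_{H^α}` on `ℍ³`. -/
def sobNorm (α : ℝ) (g : ℝ → ℂ) : ℝ :=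
  (∫ l in Set.Ioi (0 : ℝ), (l ^ 2 + 1) ^ α * ‖g l‖ ^ 2 * l ^ 2) ^ ((1 : ℝ) / 2)

/-- The measure `sinh²(s) ds` on the geodesic ball `B_R` (radial coordinates). -/
def ballMeasure (R : ℝ) : Measure ℝ :=
  (volume.restrict (Set.Ioo 0 R)).withDensity (fun s => ENNReal.ofReal (Real.sinh s ^ 2))

end

lemma aux_ker (l s : ℝ) (hl : 0 < l) (hs : 0 < s) :
    |Real.sin (l * s) / (l * Real.sinh s)| ≤ 1 := by
  have h1 : s ≤ Real.sinh s := Real.self_le_sinh_iff.2 hs.le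
  have h2 : 0 < l * Real.sinh s := mul_pos hl (lt_of_lt_of_le hs h1)
  rw [abs_div, abs_of_pos h2, div_le_one h2]
  calc |Real.sin (l * s)| ≤ |l * s| := Real.abs_sin_le_abs
    _ = l * s := abs_of_pos (mul_pos hl hs)
    _ ≤ _ := by gcongr

lemma aux_int1 (α : ℝ) (hα : 3 / 2 < α) :
    Integrable (fun l : ℝ => ((l ^ 2 + 1) ^ (-(α / 2)) * l) ^ 2) := by
  have h := integrable_rpow_neg_one_add_norm_sq (E := ℝ) (μ := volume) (r := 2 * α - 2)
    (by simp; linarith)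
  refine h.mono' ?_ ?_
  · apply Continuous.aestronglyMeasurable
    refine Continuous.pow (Continuous.mul (Continuous.rpow_const (by fun_prop) ?_) continuous_id) 2
    intro x; left; positivity
  · refine Eventually.of_forall fun l => ?_
    have hp : 0 < l ^ 2 + 1 := by positivity
    rw [Real.norm_of_nonneg (by positivity), mul_pow, ← Real.rpow_natCast, ← Real.rpow_mul hp.le]
    have e : (1 + ‖l‖ ^ 2) ^ (-(2 * α - 2) / 2) = (l ^ 2 + 1) ^ (-α) * (l ^ 2 + 1) := by
      rw [← Real.rpow_add_one hp.ne']
      rw [Real.norm_eq_abs, sq_abs, add_comm]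
      congr 1; ring
    rw [e]
    have e2 : -(α / 2) * ((2 : ℕ) : ℝ) = -α := by push_cast; ring
    rw [e2]
    gcongr
    linarith

lemma aux_int2 (α : ℝ) (hα : 3 / 2 < α) (g : SchwartzMap ℝ ℂ) :
    Integrable (fun l : ℝ => (l ^ 2 + 1) ^ α * ‖g l‖ ^ 2 * l ^ 2) := by
  obtain ⟨n, hn⟩ := exists_nat_ge α
  obtain ⟨C, hC⟩ : ∃ C : ℝ, ∀ x : ℝ, (1 + ‖x‖) ^ (n + 2) * ‖g x‖ ≤ C := by
    have h0 := fun x => SchwartzMap.one_add_le_sup_seminorm_apply (𝕜 := ℝ) (m := (n + 2, 0))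
      (k := n + 2) (n := 0) le_rfl le_rfl g x
    simp only [norm_iteratedFDeriv_zero] at h0
    exact ⟨_, h0⟩
  have h := (integrable_inv_one_add_sq).const_mul (C ^ 2)
  refine h.mono' ?_ ?_
  · apply Continuous.aestronglyMeasurable
    refine Continuous.mul (Continuous.mul (Continuous.rpow_const (by fun_prop) ?_)
      (by fun_prop)) (by fun_prop)
    intro x; left; positivity
  · refine Eventually.of_forall fun l => ?_
    have hp : 0 < l ^ 2 + 1 := by positivity
    rw [Real.norm_of_nonneg (by positivity), ← div_eq_mul_inv, le_div_iff₀ (by positivity)]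
    have h1 : (l ^ 2 + 1) ^ α ≤ (l ^ 2 + 1) ^ n := by
      rw [← Real.rpow_natCast _ n]
      exact Real.rpow_le_rpow_of_exponent_le (by nlinarith) hn
    have h2 : l ^ 2 + 1 ≤ (1 + ‖l‖) ^ 2 := by
      rw [Real.norm_eq_abs]; nlinarith [abs_nonneg l, sq_abs l]
    calc (l ^ 2 + 1) ^ α * ‖g l‖ ^ 2 * l ^ 2 * (1 + l ^ 2)
        ≤ (l ^ 2 + 1) ^ n * ‖g l‖ ^ 2 * (l ^ 2 + 1) * (l ^ 2 + 1) := by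
          rw [add_comm 1 (l ^ 2)]
          have h3 : l ^ 2 ≤ l ^ 2 + 1 := by linarith
          gcongr
      _ = (l ^ 2 + 1) ^ (n + 2) * ‖g l‖ ^ 2 := by ring
      _ ≤ ((1 + ‖l‖) ^ 2) ^ (n + 2) * ‖g l‖ ^ 2 := by gcongr
      _ = ((1 + ‖l‖) ^ (n + 2) * ‖g l‖) ^ 2 := by rw [mul_pow, ← pow_mul, ← pow_mul, mul_comm 2]
      _ ≤ C ^ 2 := by gcongr; exact hC l

lemma aux_cs (α : ℝ) (hα : 3 / 2 < α) (g : SchwartzMap ℝ ℂ) :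
    ∫ l in Set.Ioi (0 : ℝ), ‖g l‖ * l ^ 2 ≤
      (∫ l in Set.Ioi (0 : ℝ), ((l ^ 2 + 1) ^ (-(α / 2)) * l) ^ 2) ^ ((1 : ℝ) / 2)
        * sobNorm α g := by
  have key : ∀ l : ℝ, ((l ^ 2 + 1) ^ (α / 2) * ‖g l‖ * l) ^ 2
      = (l ^ 2 + 1) ^ α * ‖g l‖ ^ 2 * l ^ 2 := by
    intro l
    have hp : 0 < l ^ 2 + 1 := by positivity
    rw [mul_pow, mul_pow, ← Real.rpow_natCast (_ ^ (α / 2)), ← Real.rpow_mul hp.le]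
    congr 4; push_cast; ring
  have m1 : MemLp (fun l : ℝ => (l ^ 2 + 1) ^ (-(α / 2)) * l) (ENNReal.ofReal 2)
      (volume.restrict (Set.Ioi 0)) := by
    rw [ENNReal.ofReal_ofNat, memLp_two_iff_integrable_sq]
    · exact (aux_int1 α hα).integrableOn
    · apply Continuous.aestronglyMeasurable
      refine (Continuous.mul (Continuous.rpow_const (by fun_prop) ?_) continuous_id)
      intro x; left; positivity
  have m2 : MemLp (fun l : ℝ => (l ^ 2 + 1) ^ (α / 2) * ‖g l‖ * l) (ENNReal.ofReal 2)
      (volume.restrict (Set.Ioi 0)) := by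
    rw [ENNReal.ofReal_ofNat, memLp_two_iff_integrable_sq]
    · simp_rw [key]
      exact (aux_int2 α hα g).integrableOn
    · apply Continuous.aestronglyMeasurable
      refine Continuous.mul (Continuous.mul (Continuous.rpow_const (by fun_prop) ?_)
        (by fun_prop)) (by fun_prop)
      intro x; left; positivity
  have := integral_mul_le_Lp_mul_Lq_of_nonneg Real.HolderConjugate.two_two
    (ae_restrict_of_forall_mem measurableSet_Ioi (fun l (hl : 0 < l) => by
      simp only [Pi.zero_apply]; positivity))
    (ae_restrict_of_forall_mem measurableSet_Ioi (fun l (hl : 0 < l) => by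
      simp only [Pi.zero_apply]; positivity)) m1 m2
  simp only [Real.rpow_ofNat, key] at this
  refine le_trans (le_of_eq ?_) this
  refine integral_congr_ae (Eventually.of_forall fun l => ?_)
  have hp : 0 < l ^ 2 + 1 := by positivity
  have : (l ^ 2 + 1) ^ (-(α / 2)) * (l ^ 2 + 1) ^ (α / 2) = 1 := by
    rw [← Real.rpow_add hp]; simp
  simp only
  linear_combination (-‖g l‖ * l ^ 2) * this

lemma aux_int3 (g : SchwartzMap ℝ ℂ) : Integrable (fun l : ℝ => ‖g l‖ * l ^ 2) := by
  have := g.integrable_pow_mul volume 2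
  refine this.congr (Eventually.of_forall fun l => ?_)
  simp [mul_comm]

lemma aux_prop (g : SchwartzMap ℝ ℂ) (t s : ℝ) (hs : 0 < s) :
    ‖Sprop g t s‖ ≤ ∫ l in Set.Ioi (0 : ℝ), ‖g l‖ * l ^ 2 := by
  refine norm_integral_le_of_norm_le (aux_int3 g).integrableOn ?_
  refine ae_restrict_of_forall_mem measurableSet_Ioi (fun l (hl : 0 < l) => ?_)
  have h := aux_ker l s hl hs
  rw [norm_mul, norm_mul, norm_mul, Complex.norm_real, Real.norm_eq_abs, mul_comm Complex.I,
    Complex.norm_exp_ofReal_mul_I, norm_pow, Complex.norm_real, Real.norm_eq_abs, sq_abs, mul_one]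
  calc _ ≤ 1 * ‖g l‖ * l ^ 2 := by gcongr
    _ = _ := by ring

lemma aux_fin (R : ℝ) : ballMeasure R Set.univ < ∞ := by
  have : ballMeasure R Set.univ = ∫⁻ s in Set.Ioo 0 R, ENNReal.ofReal (Real.sinh s ^ 2) := by
    rw [ballMeasure, withDensity_apply _ MeasurableSet.univ, Measure.restrict_univ]
  rw [this]
  calc _ ≤ ∫⁻ s in Set.Ioo 0 R, ENNReal.ofReal (Real.sinh R ^ 2) := by
        refine setLIntegral_mono measurable_const fun s hs => ?_
        have : 0 ≤ Real.sinh s := Real.sinh_nonneg_iff.2 hs.1.le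
        have : Real.sinh s ≤ Real.sinh R := Real.sinh_le_sinh.2 hs.2.le
        gcongr
    _ < ∞ := by
        rw [setLIntegral_const]
        exact ENNReal.mul_lt_top ENNReal.ofReal_lt_top (by simp)

/-- Theorem 1.1(iv) on `ℍ³`: if `α > 3/2` the local maximal estimate holds
for every `q ∈ [1, ∞]`. -/
theorem schrodinger_maximal_sufficient_high_regularity
    (α : ℝ) (hα : 3 / 2 < α) (q : ℝ≥0∞) (hq : 1 ≤ q)
    (R : ℝ) (hR : 0 < R) :
    ∃ C : ℝ, 0 < C ∧ ∀ g : SchwartzMap ℝ ℂ, (∀ x, g (-x) = g x) →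
      eLpNorm (Sstar ⇑g) q (ballMeasure R) ≤ ENNReal.ofReal (C * sobNorm α ⇑g) := by
  set K : ℝ := (∫ l in Set.Ioi (0 : ℝ), ((l ^ 2 + 1) ^ (-(α / 2)) * l) ^ 2) ^ ((1 : ℝ) / 2) with hK
  have hK0 : 0 ≤ K := Real.rpow_nonneg (integral_nonneg fun l => sq_nonneg _) _
  set V : ℝ≥0∞ := ballMeasure R Set.univ ^ q.toReal⁻¹ with hV
  have hVt : V ≠ ∞ := ENNReal.rpow_ne_top_of_nonneg (by positivity) (aux_fin R).ne
  refine ⟨V.toReal * K + 1, by positivity, fun g _ => ?_⟩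
  have hs0 : 0 ≤ sobNorm α g := Real.rpow_nonneg (integral_nonneg fun l => by positivity) _
  have hb : ∀ᵐ s ∂(ballMeasure R), ‖Sstar g s‖ ≤ K * sobNorm α g := by
    refine (withDensity_absolutelyContinuous _ _).ae_le ?_
    refine ae_restrict_of_forall_mem measurableSet_Ioo fun s hs => ?_
    rw [Sstar, Real.norm_of_nonneg (Real.iSup_nonneg fun _ => norm_nonneg _)]
    exact Real.iSup_le (fun t => (aux_prop g t s hs.1).trans (aux_cs α hα g)) (by positivity)
  refine (eLpNorm_le_of_ae_bound hb).trans ?_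
  rw [← hV, ← ENNReal.ofReal_toReal hVt, ← ENNReal.ofReal_mul ENNReal.toReal_nonneg]
  apply ENNReal.ofReal_le_ofReal
  rw [ENNReal.ofReal_toReal hVt]
  nlinarith
end

section
/- (Theorem 1.2, positive part.) For every α > 1/2 there is a constant C > 0 such that (∫₀^∞ (S*g(s))² sinh²(s) ds)^{1/2} ≤ C ‖g‖_{H^α} for all even Schwartz functions g : ℝ → ℂ; that is, the global maximal estimate ‖S*g‖_{L²(ℍ³)} ≤ C ‖g‖_{H^α} holds. -/
open MeasureTheory Filter Set ENNReal

noncomputable section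

/-- The oscillating phase `e^{i(xξ+tξ²)}`. -/
def ph (t x ξ : ℝ) : ℂ := Complex.exp (((x * ξ + t * ξ ^ 2 : ℝ) : ℂ) * Complex.I)

lemma norm_ph (t x ξ : ℝ) : ‖ph t x ξ‖ = 1 := Complex.norm_exp_ofReal_mul_I _

lemma conj_ph (t x ξ : ℝ) : (starRingEnd ℂ) (ph t x ξ) = ph (-t) (-x) ξ := by
  unfold ph
  rw [← Complex.exp_conj]
  congr 1
  simp
  ring

lemma ph_mul (t x t₂ x₂ ξ : ℝ) : ph t x ξ * ph t₂ x₂ ξ = ph (t + t₂) (x + x₂) ξ := by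
  unfold ph
  rw [← Complex.exp_add]
  congr 1
  push_cast
  ring

lemma continuous_ph : Continuous (fun p : ℝ × ℝ × ℝ => ph p.1 p.2.1 p.2.2) := by
  unfold ph
  fun_prop

lemma measurable_ph {β : Type*} [MeasurableSpace β] {t x ξ : β → ℝ} (ht : Measurable t)
    (hx : Measurable x) (hξ : Measurable ξ) : Measurable (fun b => ph (t b) (x b) (ξ b)) :=
  continuous_ph.measurable.comp (ht.prodMk (hx.prodMk hξ))

/-- Majorant profile. -/
def mj (y : ℝ) : ℝ := Real.sqrt Real.pi * (|y| ^ (-(1 / 2) : ℝ) * Real.exp (-(1 / 16) * y ^ 2))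

lemma mj_nonneg (y : ℝ) : 0 ≤ mj y := by unfold mj; positivity

lemma mj_measurable : Measurable mj := by
  unfold mj
  fun_prop

lemma mj_integrable : Integrable mj := by
  have h := (integrableOn_rpow_mul_exp_neg_mul_sq (b := 1 / 16) (by norm_num)
    (s := -(1 / 2)) (by norm_num))
  rw [← integrable_indicator_iff measurableSet_Ioi] at h
  refine Integrable.const_mul ?_ _
  refine (h.add h.comp_neg).congr (Filter.Eventually.of_forall fun x => ?_)
  rcases lt_trichotomy x 0 with hx | hx | hx
  · have h1 : ¬ (0 < x) := by linarith
    simp [indicator, h1, hx, abs_of_neg hx]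
  · subst hx
    simp
  · have h1 : ¬ (x < 0) := by linarith
    simp [indicator, h1, hx, abs_of_pos hx]

lemma mj_scaled {a : ℝ} (ha : 0 < a) :
    ∫⁻ z, ENNReal.ofReal (mj (Real.sqrt a * z))
      = ENNReal.ofReal (a ^ (-(1 / 2) : ℝ) * ∫ y, mj y) := by
  have hs : Real.sqrt a ≠ 0 := (Real.sqrt_pos.2 ha).ne'
  rw [← ofReal_integral_eq_lintegral_ofReal (mj_integrable.comp_mul_left' hs)
    (Filter.Eventually.of_forall fun _ => mj_nonneg _), Measure.integral_comp_mul_left,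
    smul_eq_mul, abs_of_nonneg (by positivity), Real.rpow_neg ha.le, Real.sqrt_eq_rpow]

lemma key_ineq {q : ℝ} (hq : 0 ≤ q) : q ^ (1 / 2 : ℝ) ≤ Real.exp (q ^ 2 / 8) := by
  have h1 := Real.add_one_le_exp (q ^ 2 / 8)
  have h2 : q ^ (1 / 2 : ℝ) ≤ (1 + q) / 2 := by
    rw [← Real.sqrt_eq_rpow]
    nlinarith [Real.sq_sqrt hq, sq_nonneg (Real.sqrt q - 1)]
  nlinarith [sq_nonneg (q / 2 - 1)]

lemma gauss_bound {a t z : ℝ} (ha : 0 < a) (ha1 : a ≤ 1) (ht : |t| ≤ 1) (hz : z ≠ 0) :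
    ‖∫ ξ : ℝ, ((Real.exp (-a * ξ ^ 2) : ℝ) : ℂ) * ph t z ξ‖ ≤ mj (Real.sqrt a * z) := by
  set b : ℂ := (a : ℂ) - t * Complex.I with hb
  have hre : b.re = a := by simp [hb]
  have him : b.im = -t := by simp [hb]
  have hI : ∫ ξ : ℝ, ((Real.exp (-a * ξ ^ 2) : ℝ) : ℂ) * ph t z ξ
      = (Real.pi / b) ^ (1 / 2 : ℂ) * Complex.exp (-(z : ℂ) ^ 2 / (4 * b)) := by
    rw [← fourierIntegral_gaussian (by rw [hre]; exact ha)]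
    congr 1
    ext ξ
    unfold ph
    push_cast
    rw [← Complex.exp_add, ← Complex.exp_add]
    congr 1
    rw [hb]
    ring
  have hbne : b ≠ 0 := by
    intro h
    rw [h] at hre
    simp at hre
    linarith
  have hr : 0 < ‖b‖ := norm_pos_iff.2 hbne
  have hr2 : ‖b‖ ^ 2 = a ^ 2 + t ^ 2 := by
    rw [← Complex.normSq_eq_norm_sq, Complex.normSq_apply, hre, him]; ring
  have hr3 : ‖b‖ ^ 2 ≤ 2 := by
    rw [hr2]
    have := sq_abs t
    nlinarith [abs_nonneg t]
  have hexp : (-(z : ℂ) ^ 2 / (4 * b)).re = -(z ^ 2 * a / (4 * ‖b‖ ^ 2)) := by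
    have : -(z : ℂ) ^ 2 / (4 * b) = ((-z ^ 2 / 4 : ℝ) : ℂ) * b⁻¹ := by
      push_cast
      field_simp
    rw [this, Complex.re_ofReal_mul, Complex.inv_re, Complex.normSq_eq_norm_sq, hre]
    field_simp
  rw [hI, norm_mul, Complex.norm_exp, hexp]
  have h12 : (1 / 2 : ℂ) = ((1 / 2 : ℝ) : ℂ) := by push_cast; rfl
  rw [h12, Complex.norm_cpow_real, norm_div, Complex.norm_real, Real.norm_of_nonneg Real.pi_pos.le,
    Real.div_rpow Real.pi_pos.le hr.le, ← Real.sqrt_eq_rpow]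
  unfold mj
  set y := Real.sqrt a * z with hy
  have hy2 : y ^ 2 = z ^ 2 * a := by rw [hy, mul_pow, Real.sq_sqrt ha.le]; ring
  have hy0 : 0 < |y| := abs_pos.2 (mul_ne_zero (Real.sqrt_pos.2 ha).ne' hz)
  rw [div_mul_eq_mul_div, mul_div_assoc]
  refine mul_le_mul_of_nonneg_left ?_ (Real.sqrt_nonneg _)
  have hk := key_ineq (q := |y| / ‖b‖) (by positivity)
  rw [Real.div_rpow hy0.le hr.le, div_pow, sq_abs, hy2] at hk
  rw [Real.rpow_neg hy0.le, hy2, ← hy2]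
  have hP : 0 < |y| ^ (1 / 2 : ℝ) := by positivity
  have hQ : 0 < ‖b‖ ^ (1 / 2 : ℝ) := by positivity
  rw [div_le_iff₀ hQ] at hk ⊢
  rw [hy2]
  have e1 : Real.exp (-(z ^ 2 * a / (4 * ‖b‖ ^ 2)))
      = Real.exp (-(z ^ 2 * a / ‖b‖ ^ 2 / 8)) * Real.exp (-(z ^ 2 * a / ‖b‖ ^ 2 / 8)) := by
    rw [← Real.exp_add]; congr 1; field_simp; ring
  have e2 : Real.exp (-(z ^ 2 * a / ‖b‖ ^ 2 / 8)) ≤ Real.exp (-(1 / 16) * (z ^ 2 * a)) := by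
    apply Real.exp_le_exp.2
    have : z ^ 2 * a / 2 ≤ z ^ 2 * a / ‖b‖ ^ 2 := by
      apply div_le_div_of_nonneg_left (by positivity) (by positivity) hr3
    linarith
  have e3 : Real.exp (-(z ^ 2 * a / ‖b‖ ^ 2 / 8)) * Real.exp (z ^ 2 * a / ‖b‖ ^ 2 / 8) = 1 := by
    rw [← Real.exp_add]; simp
  have e4 : Real.exp (-(z ^ 2 * a / ‖b‖ ^ 2 / 8)) ≤ (|y| ^ (1 / 2 : ℝ))⁻¹ * ‖b‖ ^ (1 / 2 : ℝ) := by
    rw [inv_mul_eq_div, le_div_iff₀ hP]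
    calc _ ≤ Real.exp (-(z ^ 2 * a / ‖b‖ ^ 2 / 8)) *
          (Real.exp (z ^ 2 * a / ‖b‖ ^ 2 / 8) * ‖b‖ ^ (1 / 2 : ℝ)) := by gcongr
      _ = _ := by rw [← mul_assoc, e3, one_mul]
  rw [e1]
  calc _ ≤ ((|y| ^ (1 / 2 : ℝ))⁻¹ * ‖b‖ ^ (1 / 2 : ℝ)) * Real.exp (-(1 / 16) * (z ^ 2 * a)) := by
        gcongr
    _ = _ := by ring

/-- The dual (adjoint) operator. -/
def Gd (τ : ℝ → ℝ) (v : ℝ → ℂ) (ξ : ℝ) : ℂ := ∫ x, ph (τ x) x ξ * v x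

lemma Gd_measurable {τ : ℝ → ℝ} (hτ : Measurable τ) {v : ℝ → ℂ} (hv : Measurable v) :
    Measurable (Gd τ v) := by
  have : StronglyMeasurable (Function.uncurry fun ξ x : ℝ => ph (τ x) x ξ * v x) := by
    apply Measurable.stronglyMeasurable
    exact (measurable_ph (hτ.comp measurable_snd) measurable_snd measurable_fst).mul
      (hv.comp measurable_snd)
  exact this.integral_prod_right.measurable

lemma ennreal_mul_le (a b : ℝ≥0∞) : a * b ≤ a ^ 2 + b ^ 2 := by
  rcases le_total a b with h | h
  · calc a * b ≤ b * b := by gcongr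
      _ = b ^ 2 := (sq b).symm
      _ ≤ _ := le_add_self
  · calc a * b ≤ a * a := by gcongr
      _ = a ^ 2 := (sq a).symm
      _ ≤ _ := le_self_add

lemma kernel_bound {k : ℝ → ℝ≥0∞} (hk : Measurable k) {w : ℝ → ℝ≥0∞} (hw : Measurable w) :
    ∫⁻ x, ∫⁻ y, w x * w y * k (x - y) ≤ 2 * (∫⁻ z, k z) * ∫⁻ x, w x ^ 2 := by
  have h1 : ∫⁻ x, ∫⁻ y, w x ^ 2 * k (x - y) = (∫⁻ z, k z) * ∫⁻ x, w x ^ 2 := by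
    have : ∀ x, ∫⁻ y, w x ^ 2 * k (x - y) = (∫⁻ z, k z) * w x ^ 2 := fun x => by
      rw [lintegral_const_mul _ (by fun_prop), lintegral_sub_left_eq_self k x, mul_comm]
    simp_rw [this]
    rw [lintegral_const_mul _ (by fun_prop)]
  have h2 : ∫⁻ x, ∫⁻ y, w y ^ 2 * k (x - y) = (∫⁻ z, k z) * ∫⁻ x, w x ^ 2 := by
    rw [lintegral_lintegral_swap (by fun_prop)]
    have : ∀ y, ∫⁻ x, w y ^ 2 * k (x - y) = (∫⁻ z, k z) * w y ^ 2 := fun x => by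
      rw [lintegral_const_mul _ (by fun_prop), lintegral_sub_right_eq_self k x, mul_comm]
    simp_rw [this]
    rw [lintegral_const_mul _ (by fun_prop)]
  calc _ ≤ ∫⁻ x, ∫⁻ y, (w x ^ 2 * k (x - y) + w y ^ 2 * k (x - y)) := by
        gcongr with x y
        rw [← add_mul]
        gcongr
        exact ennreal_mul_le _ _
    _ = ∫⁻ x, ((∫⁻ y, w x ^ 2 * k (x - y)) + ∫⁻ y, w y ^ 2 * k (x - y)) := by
        congr 1; ext x; rw [lintegral_add_left (by fun_prop)]
    _ = _ := by
        rw [lintegral_add_left, h1, h2]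
        · ring
        · have : Measurable (fun p : ℝ × ℝ => w p.1 ^ 2 * k (p.1 - p.2)) := by fun_prop
          exact this.lintegral_prod_right'

lemma Gd_gauss {τ : ℝ → ℝ} (hτ : Measurable τ) (hτ0 : ∀ x, τ x ∈ Ioo (0 : ℝ) 1) {v : ℝ → ℂ}
    (hv : Measurable v) (hvi : Integrable v) {a : ℝ} (ha : 0 < a) (ha1 : a ≤ 1) :
    ∫⁻ ξ, ENNReal.ofReal (Real.exp (-a * ξ ^ 2)) * ‖Gd τ v ξ‖ₑ ^ 2
      ≤ 2 * ENNReal.ofReal (a ^ (-(1 / 2) : ℝ) * ∫ y, mj y) * ∫⁻ x, ‖v x‖ₑ ^ 2 := by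
  set P : ℝ → ℝ × ℝ → ℂ := fun ξ z => ((Real.exp (-a * ξ ^ 2) : ℝ) : ℂ) *
    (ph (τ z.1) z.1 ξ * v z.1 * (ph (-τ z.2) (-z.2) ξ * (starRingEnd ℂ) (v z.2))) with hP
  have hexpi : Integrable (fun ξ : ℝ => ((Real.exp (-a * ξ ^ 2) : ℝ) : ℂ)) :=
    (integrable_exp_neg_mul_sq ha).ofReal
  have hvc : Measurable (fun x => (starRingEnd ℂ) (v x)) :=
    Complex.continuous_conj.measurable.comp hv
  have hPm : Measurable (Function.uncurry P) := by
    simp only [hP]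
    refine Measurable.mul (by fun_prop) (Measurable.mul (Measurable.mul ?_ (by fun_prop))
      (Measurable.mul ?_ ?_))
    · exact measurable_ph (by fun_prop) (by fun_prop) (by fun_prop)
    · exact measurable_ph (by fun_prop) (by fun_prop) (by fun_prop)
    · exact hvc.comp (by fun_prop)
  have hvi' : Integrable (fun x => (starRingEnd ℂ) (v x)) :=
    hvi.mono hvc.aestronglyMeasurable (Filter.Eventually.of_forall fun x => by simp)
  have hPi : Integrable (Function.uncurry P) (volume.prod (volume.prod volume)) := by
    refine (hexpi.mul_prod (hvi.mul_prod hvi')).mono hPm.aestronglyMeasurable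
      (Filter.Eventually.of_forall fun p => ?_)
    simp only [hP, Function.uncurry, norm_mul, norm_ph, one_mul, le_refl]
  have hcx : ∀ ξ, ∫ z, P ξ z ∂(volume.prod volume)
      = ((Real.exp (-a * ξ ^ 2) * ‖Gd τ v ξ‖ ^ 2 : ℝ) : ℂ) := by
    intro ξ
    simp only [hP]
    rw [integral_const_mul, integral_prod_mul (fun x => ph (τ x) x ξ * v x)
      (fun y => ph (-τ y) (-y) ξ * (starRingEnd ℂ) (v y))]
    have : ∫ y, ph (-τ y) (-y) ξ * (starRingEnd ℂ) (v y) = (starRingEnd ℂ) (Gd τ v ξ) := by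
      unfold Gd
      rw [← integral_conj]
      congr 1
      ext y
      rw [map_mul, conj_ph]
    rw [this]
    change _ * (Gd τ v ξ * _) = _
    rw [Complex.mul_conj, Complex.normSq_eq_norm_sq]
    push_cast
    rfl
  have hint : Integrable (fun ξ => Real.exp (-a * ξ ^ 2) * ‖Gd τ v ξ‖ ^ 2) := by
    have := hPi.integral_prod_left
    simp only [Function.uncurry_apply_pair, hcx] at this
    exact (this.re).congr (Filter.Eventually.of_forall fun ξ => RCLike.ofReal_re _)
  have hswap : ((∫ ξ, Real.exp (-a * ξ ^ 2) * ‖Gd τ v ξ‖ ^ 2 : ℝ) : ℂ)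
      = ∫ z, (∫ ξ, P ξ z) ∂(volume.prod volume) := by
    rw [← integral_integral_swap hPi]
    simp_rw [hcx]
    exact integral_ofReal.symm
  have hinner : ∀ z : ℝ × ℝ, ∫ ξ, P ξ z = v z.1 * (starRingEnd ℂ) (v z.2) *
      ∫ ξ : ℝ, ((Real.exp (-a * ξ ^ 2) : ℝ) : ℂ) * ph (τ z.1 - τ z.2) (z.1 - z.2) ξ := by
    intro z
    rw [← integral_const_mul]
    congr 1
    ext ξ
    simp only [hP]
    rw [sub_eq_add_neg, sub_eq_add_neg, ← ph_mul]
    ring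
  have hpm : Measurable (fun z => ∫ ξ, P ξ z) := by
    have : StronglyMeasurable (Function.uncurry fun z ξ => P ξ z) :=
      (hPm.comp measurable_swap).stronglyMeasurable
    exact this.integral_prod_right.measurable
  calc ∫⁻ ξ, ENNReal.ofReal (Real.exp (-a * ξ ^ 2)) * ‖Gd τ v ξ‖ₑ ^ 2
      = ∫⁻ ξ, ENNReal.ofReal (Real.exp (-a * ξ ^ 2) * ‖Gd τ v ξ‖ ^ 2) := by
        congr 1; ext ξ
        rw [ENNReal.ofReal_mul (Real.exp_pos _).le, ENNReal.ofReal_pow (norm_nonneg _),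
          ofReal_norm]
    _ = ENNReal.ofReal (∫ ξ, Real.exp (-a * ξ ^ 2) * ‖Gd τ v ξ‖ ^ 2) := by
        rw [ofReal_integral_eq_lintegral_ofReal hint
          (Filter.Eventually.of_forall fun ξ => by positivity)]
    _ ≤ ‖((∫ ξ, Real.exp (-a * ξ ^ 2) * ‖Gd τ v ξ‖ ^ 2 : ℝ) : ℂ)‖ₑ := by
        rw [← ofReal_norm, Complex.norm_real]
        exact ENNReal.ofReal_le_ofReal (Real.le_norm_self _)
    _ ≤ ∫⁻ z, ‖∫ ξ, P ξ z‖ₑ ∂(volume.prod volume) := by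
        rw [hswap]; exact enorm_integral_le_lintegral_enorm _
    _ = ∫⁻ x, ∫⁻ y, ‖∫ ξ, P ξ (x, y)‖ₑ := lintegral_prod _ hpm.enorm.aemeasurable
    _ ≤ ∫⁻ x, ∫⁻ y, ‖v x‖ₑ * ‖v y‖ₑ * ENNReal.ofReal (mj (Real.sqrt a * (x - y))) := by
        refine lintegral_mono fun x => lintegral_mono_ae ?_
        have : ∀ᵐ y : ℝ, y ≠ x := by
          simp [ae_iff]
        filter_upwards [this] with y hy
        rw [hinner, enorm_mul, enorm_mul]
        have e1 : ‖(starRingEnd ℂ) (v y)‖ₑ = ‖v y‖ₑ := by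
          rw [← ofReal_norm, ← ofReal_norm, RCLike.norm_conj]
        rw [e1]
        gcongr
        rw [← ofReal_norm]
        refine ENNReal.ofReal_le_ofReal (gauss_bound ha ha1 ?_ (sub_ne_zero.2 hy.symm))
        have h1 := hτ0 x
        have h2 := hτ0 y
        rw [abs_le]
        constructor <;> linarith [h1.1, h1.2, h2.1, h2.2]
    _ ≤ _ := by
        rw [← mj_scaled ha]
        exact kernel_bound (k := fun z => ENNReal.ofReal (mj (Real.sqrt a * z)))
          ((mj_measurable.comp (by fun_prop)).ennreal_ofReal) hv.enorm

lemma lint_rpow {r c : ℝ} (hr : -1 < r) (hc : 0 ≤ c) :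
    ∫⁻ a in Ioc 0 c, ENNReal.ofReal (a ^ r) = ENNReal.ofReal (c ^ (r + 1) / (r + 1)) := by
  have h := intervalIntegral.intervalIntegrable_rpow' hr (a := 0) (b := c)
  rw [intervalIntegrable_iff_integrableOn_Ioc_of_le hc] at h
  rw [← ofReal_integral_eq_lintegral_ofReal h, ← intervalIntegral.integral_of_le hc,
    integral_rpow (Or.inl hr), Real.zero_rpow (by linarith), sub_zero]
  filter_upwards [ae_restrict_mem measurableSet_Ioc] with a ha
  exact Real.rpow_nonneg ha.1.le _

lemma weight_lower {α : ℝ} (hα : 1 / 2 < α) (ξ : ℝ) :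
    ENNReal.ofReal ((ξ ^ 2 + 1) ^ (-α)) ≤ ENNReal.ofReal (Real.exp 1 * α) *
      ∫⁻ a in Ioc (0 : ℝ) 1, ENNReal.ofReal (a ^ (α - 1)) *
        ENNReal.ofReal (Real.exp (-a * ξ ^ 2)) := by
  set c : ℝ := (ξ ^ 2 + 1)⁻¹ with hc
  have hp : 0 < ξ ^ 2 + 1 := by positivity
  have hc0 : 0 < c := by positivity
  have hc1 : c ≤ 1 := inv_le_one_of_one_le₀ (by nlinarith [sq_nonneg ξ])
  have hα0 : 0 < α := by linarith
  have e := lint_rpow (r := α - 1) (c := c) (by linarith) hc0.le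
  rw [sub_add_cancel] at e
  calc ENNReal.ofReal ((ξ ^ 2 + 1) ^ (-α))
      = ENNReal.ofReal (Real.exp 1 * α) * (ENNReal.ofReal (c ^ α / α) *
          ENNReal.ofReal (Real.exp (-1))) := by
        rw [← ENNReal.ofReal_mul (by positivity), ← ENNReal.ofReal_mul (by positivity)]
        congr 1
        rw [hc, Real.inv_rpow hp.le, Real.rpow_neg hp.le, Real.exp_neg]
        field_simp
    _ = ENNReal.ofReal (Real.exp 1 * α) * ∫⁻ a in Ioc (0 : ℝ) c, ENNReal.ofReal (a ^ (α - 1)) *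
          ENNReal.ofReal (Real.exp (-1)) := by
        rw [lintegral_mul_const _ (by fun_prop), e]
    _ ≤ ENNReal.ofReal (Real.exp 1 * α) * ∫⁻ a in Ioc (0 : ℝ) c, ENNReal.ofReal (a ^ (α - 1)) *
          ENNReal.ofReal (Real.exp (-a * ξ ^ 2)) := by
        refine mul_le_mul' le_rfl ?_
        refine setLIntegral_mono' measurableSet_Ioc fun a ha => ?_
        gcongr
        have : a * (ξ ^ 2 + 1) ≤ 1 := by
          calc a * (ξ ^ 2 + 1) ≤ c * (ξ ^ 2 + 1) := by gcongr; exact ha.2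
            _ = 1 := by rw [hc]; field_simp
        nlinarith [ha.1]
    _ ≤ _ := by
        refine mul_le_mul' le_rfl ?_
        exact lintegral_mono_set (Ioc_subset_Ioc_right hc1)

lemma Gd_weighted {α : ℝ} (hα : 1 / 2 < α) : ∃ C : ℝ, 0 < C ∧
    ∀ τ : ℝ → ℝ, Measurable τ → (∀ x, τ x ∈ Ioo (0 : ℝ) 1) → ∀ v : ℝ → ℂ,
      Measurable v → Integrable v →
    ∫⁻ ξ, ENNReal.ofReal ((ξ ^ 2 + 1) ^ (-α)) * ‖Gd τ v ξ‖ₑ ^ 2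
      ≤ ENNReal.ofReal C * ∫⁻ x, ‖v x‖ₑ ^ 2 := by
  set M := ∫ y, mj y with hM
  have hM0 : 0 ≤ M := integral_nonneg mj_nonneg
  set β := 1 / (α - 1 / 2) with hβ
  have hβ0 : 0 < β := by apply one_div_pos.2; linarith
  refine ⟨Real.exp 1 * α * (2 * M * β) + 1, by positivity, ?_⟩
  intro τ hτ hτ0 v hv hvi
  have hG := Gd_measurable hτ hv
  set U := ∫⁻ x, ‖v x‖ₑ ^ 2 with hU
  calc ∫⁻ ξ, ENNReal.ofReal ((ξ ^ 2 + 1) ^ (-α)) * ‖Gd τ v ξ‖ₑ ^ 2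
      ≤ ∫⁻ ξ, ENNReal.ofReal (Real.exp 1 * α) * ∫⁻ a in Ioc (0 : ℝ) 1,
          ENNReal.ofReal (a ^ (α - 1)) *
            (ENNReal.ofReal (Real.exp (-a * ξ ^ 2)) * ‖Gd τ v ξ‖ₑ ^ 2) := by
        refine lintegral_mono fun ξ => ?_
        calc _ ≤ (ENNReal.ofReal (Real.exp 1 * α) *
              ∫⁻ a in Ioc (0 : ℝ) 1, ENNReal.ofReal (a ^ (α - 1)) *
              ENNReal.ofReal (Real.exp (-a * ξ ^ 2))) * ‖Gd τ v ξ‖ₑ ^ 2 := by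
              gcongr
              exact weight_lower hα ξ
          _ = _ := by
              rw [mul_assoc, ← lintegral_mul_const _ (by fun_prop)]
              simp_rw [mul_assoc]
    _ = ENNReal.ofReal (Real.exp 1 * α) * ∫⁻ a in Ioc (0 : ℝ) 1, ∫⁻ ξ,
          ENNReal.ofReal (a ^ (α - 1)) *
            (ENNReal.ofReal (Real.exp (-a * ξ ^ 2)) * ‖Gd τ v ξ‖ₑ ^ 2) := by
        rw [lintegral_const_mul', lintegral_lintegral_swap]
        · apply Measurable.aemeasurable
          simp only [Function.uncurry_def]
          fun_prop
        · exact ENNReal.ofReal_ne_top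
    _ ≤ ENNReal.ofReal (Real.exp 1 * α) * ∫⁻ a in Ioc (0 : ℝ) 1,
          ENNReal.ofReal (a ^ (α - 1 - 1 / 2)) * (ENNReal.ofReal (2 * M) * U) := by
        refine mul_le_mul' le_rfl ?_
        refine setLIntegral_mono' measurableSet_Ioc fun a ha => ?_
        rw [lintegral_const_mul _ (by fun_prop)]
        calc _ ≤ ENNReal.ofReal (a ^ (α - 1)) *
              (2 * ENNReal.ofReal (a ^ (-(1 / 2) : ℝ) * M) * U) := by
              gcongr
              exact Gd_gauss hτ hτ0 hv hvi ha.1 ha.2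
          _ = _ := by
              have ha0 := ha.1
              rw [← mul_assoc, ← mul_assoc (ENNReal.ofReal (a ^ (α - 1 - 1 / 2)))]
              congr 1
              rw [show (2 : ℝ≥0∞) = ENNReal.ofReal 2 by simp, ← ENNReal.ofReal_mul zero_le_two,
                ← ENNReal.ofReal_mul (Real.rpow_nonneg ha0.le _),
                ← ENNReal.ofReal_mul (Real.rpow_nonneg ha0.le _)]
              congr 1
              rw [sub_eq_add_neg (α - 1), Real.rpow_add ha0]
              ring
    _ = ENNReal.ofReal (Real.exp 1 * α * (2 * M * β)) * U := by
        rw [lintegral_mul_const _ (by fun_prop), lint_rpow (by linarith) zero_le_one,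
          Real.one_rpow, ← mul_assoc, ← mul_assoc, ← ENNReal.ofReal_mul (by positivity),
          ← ENNReal.ofReal_mul]
        · congr 2
          rw [show α - 1 - 1 / 2 + 1 = α - 1 / 2 by ring, ← hβ]
          ring
        · rw [show α - 1 - 1 / 2 + 1 = α - 1 / 2 by ring, ← hβ]
          positivity
    _ ≤ _ := by
        gcongr
        linarith

/-- The one-dimensional propagator. -/
def Fp (h : ℝ → ℂ) (t x : ℝ) : ℂ := ∫ ξ, ph t x ξ * h ξ

lemma Fp_cont {h : ℝ → ℂ} (hi : Integrable h) :
    Continuous (fun p : ℝ × ℝ => Fp h p.1 p.2) := by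
  unfold Fp
  refine continuous_of_dominated (bound := fun ξ => ‖h ξ‖) ?_ ?_ hi.norm ?_
  · intro p
    refine AEStronglyMeasurable.mul ?_ hi.1
    exact (measurable_ph measurable_const measurable_const measurable_id).aestronglyMeasurable
  · intro p
    exact Filter.Eventually.of_forall fun ξ => by simp [norm_ph]
  · refine Filter.Eventually.of_forall fun ξ => Continuous.mul ?_ continuous_const
    exact continuous_ph.comp (by fun_prop : Continuous fun p : ℝ × ℝ => (p.1, p.2, ξ))

lemma Fp_bound (h : ℝ → ℂ) (t x : ℝ) : ‖Fp h t x‖ ≤ ∫ ξ, ‖h ξ‖ := by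
  unfold Fp
  refine (norm_integral_le_integral_norm _).trans (le_of_eq ?_)
  simp [norm_ph]

lemma Fp_meas {h : ℝ → ℂ} (hm : Measurable h) {τ : ℝ → ℝ} (hτ : Measurable τ) :
    Measurable (fun x => Fp h (τ x) x) := by
  have : StronglyMeasurable (Function.uncurry fun x ξ : ℝ => ph (τ x) x ξ * h ξ) := by
    apply Measurable.stronglyMeasurable
    exact (measurable_ph (hτ.comp measurable_fst) measurable_fst measurable_snd).mul
      (hm.comp measurable_snd)
  exact this.integral_prod_right.measurable

set_option maxHeartbeats 1000000 in
lemma lin_bound_cpt {α C : ℝ} (hC : 0 < C) {τ : ℝ → ℝ} (hτ : Measurable τ)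
    (hG : ∀ v : ℝ → ℂ, Measurable v → Integrable v →
      ∫⁻ ξ, ENNReal.ofReal ((ξ ^ 2 + 1) ^ (-α)) * ‖Gd τ v ξ‖ₑ ^ 2
        ≤ ENNReal.ofReal C * ∫⁻ x, ‖v x‖ₑ ^ 2)
    {h : ℝ → ℂ} (hm : Measurable h) (hi : Integrable h) (R : ℝ) :
    ∫⁻ x in Icc (-R) R, ‖Fp h (τ x) x‖ₑ ^ 2
      ≤ ENNReal.ofReal C * ∫⁻ ξ, ENNReal.ofReal ((ξ ^ 2 + 1) ^ α) * ‖h ξ‖ₑ ^ 2 := by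
  set H := ∫⁻ ξ, ENNReal.ofReal ((ξ ^ 2 + 1) ^ α) * ‖h ξ‖ₑ ^ 2 with hH
  set f : ℝ → ℂ := fun x => Fp h (τ x) x with hf
  have hfm : Measurable f := Fp_meas hm hτ
  set v : ℝ → ℂ := (Icc (-R) R).indicator (fun x => (starRingEnd ℂ) (f x)) with hv
  have hvm : Measurable v :=
    (Complex.continuous_conj.measurable.comp hfm).indicator measurableSet_Icc
  set B := ∫ ξ, ‖h ξ‖ with hB
  have hfin : volume (Icc (-R) R) < ⊤ := by simp
  have hvi : Integrable v := by
    rw [hv, integrable_indicator_iff measurableSet_Icc]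
    refine IntegrableOn.of_bound hfin
      (Complex.continuous_conj.measurable.comp hfm).aestronglyMeasurable B ?_
    exact Filter.Eventually.of_forall fun x => by simpa using Fp_bound h (τ x) x
  have hvn : ∀ x, ‖v x‖ₑ ^ 2 = (Icc (-R) R).indicator (fun x => ‖f x‖ₑ ^ 2) x := by
    intro x
    by_cases hx : x ∈ Icc (-R) R
    · simp only [hv, indicator_of_mem hx]
      rw [← ofReal_norm, RCLike.norm_conj, ofReal_norm]
    · simp [hv, indicator_of_notMem hx]
  set U := ∫⁻ x in Icc (-R) R, ‖f x‖ₑ ^ 2 with hU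
  have hUv : ∫⁻ x, ‖v x‖ₑ ^ 2 = U := by
    simp_rw [hvn]
    rw [lintegral_indicator measurableSet_Icc]
  have hUfin : U ≠ ⊤ := by
    have : U ≤ ∫⁻ x in Icc (-R) R, ENNReal.ofReal B ^ 2 := by
      refine lintegral_mono fun x => ?_
      gcongr
      rw [← ofReal_norm]
      exact ENNReal.ofReal_le_ofReal (Fp_bound h _ _)
    refine ne_top_of_le_ne_top ?_ this
    rw [setLIntegral_const]
    exact ENNReal.mul_ne_top (by simp) hfin.ne
  have hPi : Integrable (Function.uncurry fun x ξ : ℝ => v x * (ph (τ x) x ξ * h ξ))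
      (volume.prod volume) := by
    refine (hvi.mul_prod hi).mono (Measurable.aestronglyMeasurable ?_)
      (Filter.Eventually.of_forall fun p => ?_)
    · refine Measurable.mul (by fun_prop) (Measurable.mul ?_ (by fun_prop))
      exact measurable_ph (by fun_prop) (by fun_prop) (by fun_prop)
    · simp only [Function.uncurry, norm_mul, norm_ph, one_mul, le_refl]
  have hdual : ((∫ x, ‖v x‖ ^ 2 : ℝ) : ℂ) = ∫ ξ, h ξ * Gd τ v ξ := by
    have e1 : ∀ x, ∫ ξ, v x * (ph (τ x) x ξ * h ξ) = ((‖v x‖ ^ 2 : ℝ) : ℂ) := by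
      intro x
      rw [integral_const_mul]
      change v x * f x = _
      by_cases hx : x ∈ Icc (-R) R
      · simp only [hv, indicator_of_mem hx]
        rw [mul_comm, Complex.mul_conj, Complex.normSq_eq_norm_sq, RCLike.norm_conj]
      · simp [hv, indicator_of_notMem hx]
    have e2 : ∀ ξ, ∫ x, v x * (ph (τ x) x ξ * h ξ) = h ξ * Gd τ v ξ := by
      intro ξ
      unfold Gd
      rw [← integral_const_mul]
      congr 1
      ext x
      ring
    rw [show ((∫ x, ‖v x‖ ^ 2 : ℝ) : ℂ) = ∫ x, ((‖v x‖ ^ 2 : ℝ) : ℂ) from integral_ofReal.symm]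
    simp_rw [← e2]
    rw [← integral_integral_swap hPi]
    simp_rw [e1]
  have hUle : U ≤ ∫⁻ ξ, ‖h ξ‖ₑ * ‖Gd τ v ξ‖ₑ := by
    have hc : ∀ x, ENNReal.ofReal (‖v x‖ ^ 2) = ‖v x‖ₑ ^ 2 := fun x => by
      rw [ENNReal.ofReal_pow (norm_nonneg _), ofReal_norm]
    have hi2 : Integrable (fun x => ‖v x‖ ^ 2) := by
      refine ⟨by fun_prop, ?_⟩
      rw [hasFiniteIntegral_iff_ofReal (Filter.Eventually.of_forall fun x => by positivity)]
      simp_rw [hc]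
      rw [hUv]
      exact hUfin.lt_top
    calc U = ENNReal.ofReal (∫ x, ‖v x‖ ^ 2) := by
          rw [ofReal_integral_eq_lintegral_ofReal hi2
            (Filter.Eventually.of_forall fun x => by positivity), ← hUv]
          simp_rw [hc]
      _ ≤ ‖((∫ x, ‖v x‖ ^ 2 : ℝ) : ℂ)‖ₑ := by
          rw [← ofReal_norm, Complex.norm_real]
          exact ENNReal.ofReal_le_ofReal (Real.le_norm_self _)
      _ ≤ ∫⁻ ξ, ‖h ξ * Gd τ v ξ‖ₑ := by
          rw [hdual]; exact enorm_integral_le_lintegral_enorm _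
      _ = _ := by simp_rw [enorm_mul]
  have hpt : ∀ ξ, ‖h ξ‖ₑ * ‖Gd τ v ξ‖ₑ ≤
      ENNReal.ofReal (C / 2) * (ENNReal.ofReal ((ξ ^ 2 + 1) ^ α) * ‖h ξ‖ₑ ^ 2) +
      ENNReal.ofReal (C⁻¹ / 2) * (ENNReal.ofReal ((ξ ^ 2 + 1) ^ (-α)) * ‖Gd τ v ξ‖ₑ ^ 2) := by
    intro ξ
    have hp : 0 < (ξ ^ 2 + 1) ^ α := by positivity
    simp only [← ofReal_norm]
    rw [← ENNReal.ofReal_pow (norm_nonneg _), ← ENNReal.ofReal_pow (norm_nonneg _),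
      ← ENNReal.ofReal_mul (by positivity), ← ENNReal.ofReal_mul (by positivity),
      ← ENNReal.ofReal_mul (by positivity), ← ENNReal.ofReal_mul (by positivity),
      ← ENNReal.ofReal_mul (by positivity), ← ENNReal.ofReal_add (by positivity) (by positivity)]
    apply ENNReal.ofReal_le_ofReal
    rw [Real.rpow_neg (by positivity)]
    set W := (ξ ^ 2 + 1) ^ α
    set p := ‖h ξ‖
    set q := ‖Gd τ v ξ‖
    have key : 0 ≤ C⁻¹ / 2 * W⁻¹ * (C * W * p - q) ^ 2 := by positivity
    have : C⁻¹ / 2 * W⁻¹ * (C * W * p - q) ^ 2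
        = C / 2 * (W * p ^ 2) + C⁻¹ / 2 * (W⁻¹ * q ^ 2) - p * q := by
      field_simp
      ring
    linarith
  have hGm := Gd_measurable hτ hvm
  have hmain : U ≤ ENNReal.ofReal (C / 2) * H + ENNReal.ofReal (1 / 2) * U := by
    calc U ≤ _ := hUle
      _ ≤ _ := lintegral_mono hpt
      _ = ENNReal.ofReal (C / 2) * H + ENNReal.ofReal (C⁻¹ / 2) *
          ∫⁻ ξ, (ENNReal.ofReal ((ξ ^ 2 + 1) ^ (-α)) * ‖Gd τ v ξ‖ₑ ^ 2) := by
          rw [lintegral_add_left (by fun_prop), lintegral_const_mul _ (by fun_prop),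
            lintegral_const_mul _ (by fun_prop)]
      _ ≤ ENNReal.ofReal (C / 2) * H + ENNReal.ofReal (C⁻¹ / 2) * (ENNReal.ofReal C * U) := by
          gcongr
          rw [← hUv]
          exact hG v hvm hvi
      _ = _ := by
          rw [← mul_assoc (ENNReal.ofReal (C⁻¹ / 2)), ← ENNReal.ofReal_mul (by positivity)]
          congr 3
          field_simp
  by_cases hHt : H = ⊤
  · rw [hHt, ENNReal.mul_top (by simpa using hC)]
    exact le_top
  lift U to NNReal using hUfin with U₂
  lift H to NNReal using hHt with H₂
  have h3 := ENNReal.toReal_mono (by finiteness) hmain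
  rw [ENNReal.toReal_add (by finiteness) (by finiteness), ENNReal.toReal_mul, ENNReal.toReal_mul,
    ENNReal.toReal_ofReal (by positivity), ENNReal.toReal_ofReal (by positivity)] at h3
  rw [← ENNReal.toReal_le_toReal (by finiteness) (by finiteness), ENNReal.toReal_mul,
    ENNReal.toReal_ofReal (by positivity)]
  linarith

lemma lin_bound {α C : ℝ} (hC : 0 < C) {τ : ℝ → ℝ} (hτ : Measurable τ)
    (hG : ∀ v : ℝ → ℂ, Measurable v → Integrable v →
      ∫⁻ ξ, ENNReal.ofReal ((ξ ^ 2 + 1) ^ (-α)) * ‖Gd τ v ξ‖ₑ ^ 2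
        ≤ ENNReal.ofReal C * ∫⁻ x, ‖v x‖ₑ ^ 2)
    {h : ℝ → ℂ} (hm : Measurable h) (hi : Integrable h) :
    ∫⁻ x, ‖Fp h (τ x) x‖ₑ ^ 2
      ≤ ENNReal.ofReal C * ∫⁻ ξ, ENNReal.ofReal ((ξ ^ 2 + 1) ^ α) * ‖h ξ‖ₑ ^ 2 := by
  have hu : (⋃ n : ℕ, Icc (-(n : ℝ)) n) = univ := by
    refine eq_univ_of_forall fun x => ?_
    obtain ⟨n, hn⟩ := exists_nat_ge |x|
    exact mem_iUnion.2 ⟨n, abs_le.1 hn⟩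
  rw [← setLIntegral_univ, ← hu, setLIntegral_iUnion_of_directed]
  · exact iSup_le fun n => lin_bound_cpt hC hτ hG hm hi n
  · refine (monotone_nat_of_le_succ fun n => ?_).directed_le
    apply Icc_subset_Icc <;> push_cast <;> linarith

lemma exists_sel {h : ℝ → ℂ} (hi : Integrable h) : ∃ τ : ℝ → ℝ, Measurable τ ∧
    (∀ x, τ x ∈ Ioo (0 : ℝ) 1) ∧ ∀ t ∈ Ioo (0 : ℝ) 1, ∀ x, ‖Fp h t x‖ ≤ 2 * ‖Fp h (τ x) x‖ := by
  classical
  have : Nonempty (Ioo (0 : ℝ) 1) := ⟨⟨1 / 2, by norm_num, by norm_num⟩⟩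
  let s : ℕ → Ioo (0 : ℝ) 1 := TopologicalSpace.denseSeq _
  have hs : DenseRange s := TopologicalSpace.denseRange_denseSeq _
  have hc := Fp_cont hi
  let D : ℝ → ℝ := fun x => ⨆ n, ‖Fp h (s n) x‖
  have hFm : ∀ t : ℝ, Measurable fun x => ‖Fp h t x‖ := fun t =>
    (hc.comp (by fun_prop : Continuous fun x : ℝ => (t, x))).norm.measurable
  have hDm : Measurable D := Measurable.iSup fun n => hFm _
  have hbdd : ∀ x, BddAbove (range fun n => ‖Fp h (s n) x‖) := fun x =>
    ⟨∫ ξ, ‖h ξ‖, by rintro _ ⟨n, rfl⟩; exact Fp_bound h _ _⟩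
  have hle : ∀ t : Ioo (0 : ℝ) 1, ∀ x, ‖Fp h t x‖ ≤ D x := by
    intro t x
    have hcl : IsClosed {t : Ioo (0 : ℝ) 1 | ‖Fp h t x‖ ≤ D x} := by
      refine isClosed_le ?_ continuous_const
      exact (hc.comp (by fun_prop : Continuous fun t : Ioo (0 : ℝ) 1 => ((t : ℝ), x))).norm
    have : ∀ t, t ∈ {t : Ioo (0 : ℝ) 1 | ‖Fp h t x‖ ≤ D x} := fun t =>
      hs.induction_on t hcl fun n => le_ciSup (hbdd x) n
    exact this t
  have hex : ∀ x, ∃ n, D x ≤ 2 * ‖Fp h (s n) x‖ := by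
    intro x
    by_cases hD : D x ≤ 0
    · exact ⟨0, hD.trans (by positivity)⟩
    · push Not at hD
      obtain ⟨n, hn⟩ := exists_lt_of_lt_ciSup (show D x / 2 < ⨆ n, ‖Fp h (s n) x‖ from
        (by linarith : D x / 2 < D x))
      exact ⟨n, by linarith⟩
  have hN : Measurable fun x => Nat.find (hex x) :=
    measurable_find hex fun n => measurableSet_le hDm ((hFm _).const_mul 2)
  refine ⟨fun x => s (Nat.find (hex x)), ?_, fun x => (s _).2, ?_⟩
  · exact (measurable_from_top (f := fun n => (s n : ℝ))).comp hN
  · intro t ht x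
    exact (hle ⟨t, ht⟩ x).trans (Nat.find_spec (hex x))

lemma k_integrable (α : ℝ) (g : SchwartzMap ℝ ℂ) :
    Integrable (fun l : ℝ => (l ^ 2 + 1) ^ α * ‖g l‖ ^ 2 * l ^ 2) := by
  obtain ⟨n, hn⟩ := exists_nat_ge α
  set B := SchwartzMap.seminorm ℝ 0 0 g with hB
  have hgB : ∀ x, ‖g x‖ ≤ B := fun x => SchwartzMap.norm_le_seminorm ℝ g x
  have hB0 : 0 ≤ B := (norm_nonneg _).trans (hgB 0)
  have h1 := (g.integrable_pow_mul volume (2 * (n + 1))).add (g.integrable_pow_mul volume 0)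
  have hgc := g.continuous
  refine (h1.const_mul (2 ^ n * B)).mono ?_ (Filter.Eventually.of_forall fun x => ?_)
  · apply Measurable.aestronglyMeasurable
    have := hgc.measurable
    fun_prop
  · have hp : 1 ≤ x ^ 2 + 1 := by nlinarith [sq_nonneg x]
    have h2 : (x ^ 2 + 1) ^ α ≤ (x ^ 2 + 1) ^ n := by
      rw [← Real.rpow_natCast (x ^ 2 + 1) n]
      exact Real.rpow_le_rpow_of_exponent_le hp hn
    have h3 := add_pow_le (sq_nonneg x) (zero_le_one (α := ℝ)) (n + 1)
    rw [Real.norm_of_nonneg (by positivity), Real.norm_of_nonneg (by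
      simp only [Pi.add_apply]; positivity)]
    simp only [Pi.add_apply, pow_zero, one_mul, Real.norm_eq_abs, Nat.add_sub_cancel,
      one_pow, pow_mul, sq_abs] at h3 ⊢
    calc (x ^ 2 + 1) ^ α * ‖g x‖ ^ 2 * x ^ 2
        ≤ (x ^ 2 + 1) ^ n * (B * ‖g x‖) * (x ^ 2 + 1) := by
          gcongr
          · nlinarith [hgB x, norm_nonneg (g x)]
          · linarith
      _ = (x ^ 2 + 1) ^ (n + 1) * (B * ‖g x‖) := by ring
      _ ≤ (2 ^ n * ((x ^ 2) ^ (n + 1) + 1)) * (B * ‖g x‖) := by gcongr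
      _ = _ := by ring

lemma Fp_eq_Sprop (g : SchwartzMap ℝ ℂ) (hg : ∀ x, g (-x) = g x)
    (hi : Integrable (fun l : ℝ => (l : ℂ) * g l)) (t s : ℝ) (hs : 0 < s) :
    ‖Fp (fun l : ℝ => (l : ℂ) * g l) t s‖ = 2 * (Real.sinh s * ‖Sprop (⇑g) t s‖) := by
  set f : ℝ → ℂ := fun l => ph t s l * ((l : ℂ) * g l) with hf
  have hsinh : 0 < Real.sinh s := Real.sinh_pos_iff.2 hs
  have hfi : Integrable f := by
    refine hi.mono ?_ (Filter.Eventually.of_forall fun x => by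
      simp only [hf]; rw [norm_mul, norm_ph, one_mul])
    exact (measurable_ph measurable_const measurable_const
      measurable_id).aestronglyMeasurable.mul hi.1
  set c : ℂ := 2 * Complex.I * (Real.sinh s : ℝ) * Complex.exp (((-t : ℝ) : ℂ) * Complex.I) with hc
  have key : Fp (fun l : ℝ => (l : ℂ) * g l) t s = c * Sprop (⇑g) t s := by
    calc Fp (fun l : ℝ => (l : ℂ) * g l) t s = ∫ l, f l := rfl
      _ = (∫ l in Ioi (0 : ℝ), f (-l)) + ∫ l in Ioi (0 : ℝ), f l := by
          rw [integral_comp_neg_Ioi, neg_zero,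
            intervalIntegral.integral_Iic_add_Ioi hfi.integrableOn hfi.integrableOn]
      _ = ∫ l in Ioi (0 : ℝ), (f (-l) + f l) :=
          (integral_add hfi.comp_neg.integrableOn hfi.integrableOn).symm
      _ = _ := by
          unfold Sprop
          rw [← integral_const_mul]
          refine setIntegral_congr_fun measurableSet_Ioi fun l hl => ?_
          have hl0 : (l : ℂ) ≠ 0 := by
            have : (0 : ℝ) < l := hl
            exact_mod_cast this.ne'
          have hs0 : (Real.sinh s : ℂ) ≠ 0 := by exact_mod_cast hsinh.ne'
          have hsin : (Real.sin (l * s) : ℂ) = (Complex.exp (-((l * s : ℝ) : ℂ) * Complex.I)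
              - Complex.exp (((l * s : ℝ) : ℂ) * Complex.I)) * Complex.I / 2 := by
            rw [Complex.ofReal_sin]; rfl
          have e1 : f l = Complex.exp (((l * s : ℝ) : ℂ) * Complex.I) *
              Complex.exp (((t * l ^ 2 : ℝ) : ℂ) * Complex.I) * (l * g l) := by
            simp only [hf, ph]
            rw [← Complex.exp_add]
            congr 2
            push_cast
            ring
          have e2 : f (-l) = - (Complex.exp (-((l * s : ℝ) : ℂ) * Complex.I) *
              Complex.exp (((t * l ^ 2 : ℝ) : ℂ) * Complex.I) * (l * g l)) := by
            simp only [hf, ph, hg]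
            rw [← Complex.exp_add]
            push_cast
            rw [neg_mul, mul_neg]
            congr 3
            ring
          have e3 : Complex.exp (((-t : ℝ) : ℂ) * Complex.I) *
              Complex.exp (Complex.I * ((t * (l ^ 2 + 1) : ℝ) : ℂ))
              = Complex.exp (((t * l ^ 2 : ℝ) : ℂ) * Complex.I) := by
            rw [← Complex.exp_add]
            congr 1
            push_cast
            ring
          rw [e1, e2, Complex.ofReal_div, hsin, ← e3, hc, Complex.ofReal_mul l (Real.sinh s)]
          set E1 := Complex.exp (-((l * s : ℝ) : ℂ) * Complex.I)
          set E2 := Complex.exp (((l * s : ℝ) : ℂ) * Complex.I)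
          set E3 := Complex.exp (((-t : ℝ) : ℂ) * Complex.I)
          set E4 := Complex.exp (Complex.I * ((t * (l ^ 2 + 1) : ℝ) : ℂ))
          field_simp
          linear_combination (E3 * E4 * (g l) * (E2 - E1)) * Complex.I_sq
  rw [key, norm_mul, hc, norm_mul, Complex.norm_exp_ofReal_mul_I, norm_mul, norm_mul,
    Complex.norm_I, Complex.norm_real, Real.norm_of_nonneg hsinh.le]
  simp
  ring

end

/-- Theorem 1.2 on `ℍ³`, positive part: the global `L²` maximal estimate
`‖S*g‖_{L²(ℍ³)} ≤ C ‖g‖_{H^α}` holds for `α > 1/2`. -/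
theorem schrodinger_maximal_global_L2 (α : ℝ) (hα : 1 / 2 < α) :
    ∃ C : ℝ, 0 < C ∧ ∀ g : SchwartzMap ℝ ℂ, (∀ x, g (-x) = g x) →
      (∫ s in Set.Ioi (0 : ℝ), (Sstar ⇑g s) ^ 2 * Real.sinh s ^ 2) ^ ((1 : ℝ) / 2)
        ≤ C * sobNorm α ⇑g := by
  obtain ⟨C, hC, hG⟩ := Gd_weighted hα
  refine ⟨(C * 2) ^ ((1 : ℝ) / 2), by positivity, fun g hg => ?_⟩
  have hgm : Measurable g := g.continuous.measurable
  set h : ℝ → ℂ := fun l => (l : ℂ) * g l with hh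
  have hm : Measurable h := by
    simp only [hh]
    fun_prop
  have hi : Integrable h := by
    refine (g.integrable_pow_mul volume 1).mono hm.aestronglyMeasurable
      (Filter.Eventually.of_forall fun x => ?_)
    simp [hh]
  obtain ⟨τ, hτ, hτ0, hsel⟩ := exists_sel hi
  have hb := lin_bound hC hτ (hG τ hτ hτ0) hm hi
  set I := ∫ l in Set.Ioi (0 : ℝ), (l ^ 2 + 1) ^ α * ‖g l‖ ^ 2 * l ^ 2 with hI
  have hI0 : 0 ≤ I := setIntegral_nonneg measurableSet_Ioi fun l _ => by positivity
  have hH : ∫⁻ ξ, ENNReal.ofReal ((ξ ^ 2 + 1) ^ α) * ‖h ξ‖ₑ ^ 2 = ENNReal.ofReal (2 * I) := by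
    have e : ∫ l : ℝ, (l ^ 2 + 1) ^ α * ‖g l‖ ^ 2 * l ^ 2 = 2 * I := by
      rw [hI, ← integral_comp_abs (f := fun l : ℝ => (l ^ 2 + 1) ^ α * ‖g l‖ ^ 2 * l ^ 2)]
      congr 1
      ext l
      rcases abs_choice l with hl | hl <;> rw [hl]
      rw [hg, neg_sq]
    rw [← e, ofReal_integral_eq_lintegral_ofReal (k_integrable α g)
      (Filter.Eventually.of_forall fun l => by positivity)]
    congr 1
    ext l
    rw [← ofReal_norm, ← ENNReal.ofReal_pow (norm_nonneg _),
      ← ENNReal.ofReal_mul (by positivity)]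
    congr 1
    simp only [hh, norm_mul, Complex.norm_real, Real.norm_eq_abs, mul_pow, sq_abs]
    ring
  rw [hH, ← ENNReal.ofReal_mul hC.le] at hb
  have hFm := Fp_meas hm hτ
  have hc : ∀ x, ENNReal.ofReal (‖Fp h (τ x) x‖ ^ 2) = ‖Fp h (τ x) x‖ₑ ^ 2 := fun x => by
    rw [ENNReal.ofReal_pow (norm_nonneg _), ofReal_norm]
  have hFi : Integrable (fun x => ‖Fp h (τ x) x‖ ^ 2) := by
    refine ⟨(hFm.norm.pow_const 2).aestronglyMeasurable, ?_⟩
    rw [hasFiniteIntegral_iff_ofReal (Filter.Eventually.of_forall fun x => by positivity)]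
    simp_rw [hc]
    exact hb.trans_lt ENNReal.ofReal_lt_top
  have hFle : ∫ x, ‖Fp h (τ x) x‖ ^ 2 ≤ C * (2 * I) := by
    rw [← ENNReal.ofReal_le_ofReal_iff (by positivity), ofReal_integral_eq_lintegral_ofReal hFi
      (Filter.Eventually.of_forall fun x => by positivity)]
    simp_rw [hc]
    exact hb
  have hmain : ∫ s in Set.Ioi (0 : ℝ), (Sstar ⇑g s) ^ 2 * Real.sinh s ^ 2 ≤ C * (2 * I) := by
    calc _ ≤ ∫ s in Set.Ioi (0 : ℝ), ‖Fp h (τ s) s‖ ^ 2 := by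
          refine integral_mono_of_nonneg (Filter.Eventually.of_forall fun s => by
            simp only [Pi.zero_apply]; positivity) hFi.integrableOn ?_
          filter_upwards [ae_restrict_mem measurableSet_Ioi] with s hs
          have hs0 : (0 : ℝ) < s := hs
          have hsinh : 0 < Real.sinh s := Real.sinh_pos_iff.2 hs0
          rw [← mul_pow]
          have h0 : 0 ≤ Sstar (⇑g) s := Real.iSup_nonneg fun _ => norm_nonneg _
          have h1 : Sstar (⇑g) s ≤ ‖Fp h (τ s) s‖ / Real.sinh s := by
            refine Real.iSup_le (fun t => ?_) (by positivity)
            rw [le_div_iff₀ hsinh]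
            have e1 := Fp_eq_Sprop g hg hi t s hs0
            have e2 := hsel t t.2 s
            rw [e1] at e2
            linarith
          rw [le_div_iff₀ hsinh] at h1
          gcongr
      _ ≤ ∫ s, ‖Fp h (τ s) s‖ ^ 2 :=
          setIntegral_le_integral hFi (Filter.Eventually.of_forall fun x => by
            simp only [Pi.zero_apply]; positivity)
      _ ≤ _ := hFle
  unfold sobNorm
  rw [← hI, ← Real.mul_rpow (by positivity) hI0, mul_assoc]
  refine Real.rpow_le_rpow ?_ hmain (by norm_num)
  exact integral_nonneg fun s => by simp only [Pi.zero_apply]; positivity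
end

section
/- (Theorem 1.2, negative part.) For every α > 1/2 and every q ∈ [1, 2), there is no constant C > 0 such that (∫₀^∞ (S*g(s))^q sinh²(s) ds)^{1/q} ≤ C ‖g‖_{H^α} for all even Schwartz functions g : ℝ → ℂ; that is, the global maximal estimate ‖S*g‖_{L^q(ℍ³)} ≤ C ‖g‖_{H^α} fails for every q < 2. -/
open MeasureTheory Filter Set ENNReal

lemma pow_gauss_bdd (a : ℝ) (ha : 0 < a) (k : ℕ) :
    ∃ C : ℝ, ∀ x : ℝ, |x| ^ k * Real.exp (-a * x ^ 2) ≤ C := by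
  refine ⟨k.factorial * Real.exp (1 / (4 * a)), fun x => ?_⟩
  have h1 : |x| ^ k ≤ k.factorial * Real.exp |x| := by
    have := Real.pow_div_factorial_le_exp |x| (abs_nonneg x) k
    rw [div_le_iff₀ (by positivity)] at this
    linarith
  have h2 : |x| + -a * x ^ 2 ≤ 1 / (4 * a) := by
    rw [le_div_iff₀ (by positivity)]
    rw [← sq_abs x]
    nlinarith [sq_nonneg (2 * a * |x| - 1)]
  calc |x| ^ k * Real.exp (-a * x ^ 2) ≤ (k.factorial * Real.exp |x|) * Real.exp (-a * x ^ 2) := by gcongr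
    _ = k.factorial * Real.exp (|x| + -a * x ^ 2) := by rw [Real.exp_add]; ring
    _ ≤ _ := by gcongr

lemma norm_gauss (a x : ℝ) : ‖Complex.exp (-(a : ℂ) * (x : ℂ) ^ 2)‖ = Real.exp (-a * x ^ 2) := by
  have := norm_cexp_neg_mul_sq (a : ℂ) x
  simpa using this

lemma poly_gauss_bdd (a : ℝ) (ha : 0 < a) (p : Polynomial ℂ) : ∀ k : ℕ,
    ∃ C : ℝ, ∀ x : ℝ, |x| ^ k * ‖p.eval (x : ℂ) * Complex.exp (-(a : ℂ) * (x : ℂ) ^ 2)‖ ≤ C := by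
  induction p using Polynomial.induction_on' with
  | add p q hp hq =>
    intro k
    obtain ⟨C, hC⟩ := hp k
    obtain ⟨D, hD⟩ := hq k
    refine ⟨C + D, fun x => ?_⟩
    rw [Polynomial.eval_add, add_mul]
    refine le_trans (mul_le_mul_of_nonneg_left (norm_add_le _ _) (by positivity)) ?_
    rw [mul_add]
    exact add_le_add (hC x) (hD x)
  | monomial n c =>
    intro k
    obtain ⟨C, hC⟩ := pow_gauss_bdd a ha (k + n)
    refine ⟨‖c‖ * C, fun x => ?_⟩
    rw [Polynomial.eval_monomial, norm_mul, norm_mul, norm_pow, norm_gauss, Complex.norm_real,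
      Real.norm_eq_abs]
    calc _ = ‖c‖ * (|x| ^ (k + n) * Real.exp (-a * x ^ 2)) := by rw [pow_add]; ring
      _ ≤ _ := by gcongr; exact hC x

lemma iter_gauss (a : ℝ) (n : ℕ) : ∃ p : Polynomial ℂ,
    iteratedDeriv n (fun x : ℝ => Complex.exp (-(a : ℂ) * (x : ℂ) ^ 2)) =
      fun x : ℝ => p.eval (x : ℂ) * Complex.exp (-(a : ℂ) * (x : ℂ) ^ 2) := by
  induction n with
  | zero => exact ⟨1, by simp⟩
  | succ n ih =>
    obtain ⟨p, hp⟩ := ih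
    refine ⟨p.derivative + p * (Polynomial.C (-2 * (a : ℂ)) * Polynomial.X), ?_⟩
    rw [iteratedDeriv_succ, hp]
    funext x
    have h1 : HasDerivAt (fun y : ℝ => p.eval (y : ℂ)) (p.derivative.eval (x : ℂ)) x :=
      (p.hasDerivAt (x : ℂ)).comp_ofReal
    have h2 : HasDerivAt (fun y : ℂ => Complex.exp (-(a : ℂ) * y ^ 2))
        (Complex.exp (-(a : ℂ) * (x : ℂ) ^ 2) * (-(a : ℂ) * (2 * (x : ℂ)))) (x : ℂ) := by
      have := (((hasDerivAt_id (x : ℂ)).pow 2).const_mul (-(a : ℂ))).cexp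
      simpa using this
    have h3 := h1.mul h2.comp_ofReal
    have := h3.deriv
    simp only [Polynomial.eval_add, Polynomial.eval_mul, Polynomial.eval_C, Polynomial.eval_X]
    refine Eq.trans (Eq.trans ?_ this) ?_
    · rfl
    · ring

noncomputable def gaussS (a : ℝ) (ha : 0 < a) : SchwartzMap ℝ ℂ where
  toFun := fun x : ℝ => Complex.exp (-(a : ℂ) * (x : ℂ) ^ 2)
  smooth' := by
    have : ContDiff ℝ ⊤ (fun x : ℝ => (x : ℂ)) := Complex.ofRealCLM.contDiff
    have h : ContDiff ℝ ⊤ (fun x : ℝ => Complex.exp (-(a : ℂ) * (x : ℂ) ^ 2)) :=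
      (contDiff_const.mul (this.pow 2)).cexp
    exact h.of_le (by simp)
  decay' := by
    intro k n
    obtain ⟨p, hp⟩ := iter_gauss a n
    obtain ⟨C, hC⟩ := poly_gauss_bdd a ha p k
    refine ⟨C, fun x => ?_⟩
    rw [norm_iteratedFDeriv_eq_norm_iteratedDeriv, hp, Real.norm_eq_abs]
    exact hC x

lemma sin_gauss_integral (z : ℂ) (hz : 0 < z.re) (s : ℝ) :
    ∫ l in Set.Ioi (0 : ℝ), ((l * Real.sin (l * s) : ℝ) : ℂ) * Complex.exp (-z * (l : ℂ) ^ 2) =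
      (s / (4 * z)) * ((Real.pi / z) ^ (1 / 2 : ℂ) * Complex.exp (-(s : ℂ) ^ 2 / (4 * z))) := by
  have hz0 : z ≠ 0 := by rintro rfl; simp at hz
  have hmeas : AEStronglyMeasurable (fun l : ℝ => ((Real.sin (l * s) : ℝ) : ℂ)) volume := by
    fun_prop
  have hmeas2 : AEStronglyMeasurable (fun l : ℝ => ((Real.cos (l * s) : ℝ) : ℂ)) volume := by
    fun_prop
  have i1 : Integrable (fun l : ℝ => ((Real.sin (l * s) : ℝ) : ℂ) *
      Complex.exp (-z * (l : ℂ) ^ 2)) := by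
    refine (integrable_cexp_neg_mul_sq hz).bdd_mul (c := 1) hmeas (Eventually.of_forall fun l => ?_)
    rw [Complex.norm_real]; exact Real.abs_sin_le_one _
  have i2 : Integrable (fun l : ℝ => ((Real.cos (l * s) : ℝ) : ℂ) *
      Complex.exp (-z * (l : ℂ) ^ 2)) := by
    refine (integrable_cexp_neg_mul_sq hz).bdd_mul (c := 1) hmeas2 (Eventually.of_forall fun l => ?_)
    rw [Complex.norm_real]; exact Real.abs_cos_le_one _
  have i3 : Integrable (fun l : ℝ => ((Real.sin (l * s) : ℝ) : ℂ) *
      (l * Complex.exp (-z * (l : ℂ) ^ 2))) := by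
    refine (integrable_mul_cexp_neg_mul_sq hz).bdd_mul (c := 1) hmeas (Eventually.of_forall fun l => ?_)
    rw [Complex.norm_real]; exact Real.abs_sin_le_one _
  have hu : ∀ l : ℝ, HasDerivAt (fun l : ℝ => ((Real.sin (l * s) : ℝ) : ℂ))
      (((Real.cos (l * s) * s : ℝ)) : ℂ) l := by
    intro l
    have h : HasDerivAt (fun l : ℝ => Real.sin (l * s)) (Real.cos (l * s) * s) l := by
      have := ((hasDerivAt_id l).mul_const s).sin
      simpa using this
    exact h.ofReal_comp
  have hv : ∀ l : ℝ, HasDerivAt (fun l : ℝ => Complex.exp (-z * (l : ℂ) ^ 2))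
      (Complex.exp (-z * (l : ℂ) ^ 2) * (-z * (2 * (l : ℂ)))) l := by
    intro l
    have h2 : HasDerivAt (fun y : ℂ => Complex.exp (-z * y ^ 2))
        (Complex.exp (-z * (l : ℂ) ^ 2) * (-z * (2 * (l : ℂ)))) (l : ℂ) := by
      have := (((hasDerivAt_id (l : ℂ)).pow 2).const_mul (-z)).cexp
      simpa using this
    exact h2.comp_ofReal
  have ibp := integral_mul_deriv_eq_deriv_mul_of_integrable (fun l _ => hu l) (fun l _ => hv l)
    ((i3.const_mul (-2 * z)).congr (Eventually.of_forall fun l => by simp only [Pi.mul_apply]; ring))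
    ((i2.const_mul (s : ℂ)).congr (Eventually.of_forall fun l => by simp only [Pi.mul_apply]; push_cast; ring))
    i1
  have e1 : ∫ l : ℝ, ((Real.sin (l * s) : ℝ) : ℂ) * (Complex.exp (-z * (l : ℂ) ^ 2) * (-z * (2 * (l : ℂ))))
      = (-2 * z) * ∫ l : ℝ, ((l * Real.sin (l * s) : ℝ) : ℂ) * Complex.exp (-z * (l : ℂ) ^ 2) := by
    rw [← integral_const_mul]; congr 1; funext l; push_cast; ring
  have e2 : ∫ l : ℝ, (((Real.cos (l * s) * s : ℝ)) : ℂ) * Complex.exp (-z * (l : ℂ) ^ 2)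
      = s * ∫ l : ℝ, ((Real.cos (l * s) : ℝ) : ℂ) * Complex.exp (-z * (l : ℂ) ^ 2) := by
    rw [← integral_const_mul]; congr 1; funext l; push_cast; ring
  have e3 : ∫ l : ℝ, ((Real.cos (l * s) : ℝ) : ℂ) * Complex.exp (-z * (l : ℂ) ^ 2)
      = (Real.pi / z) ^ (1 / 2 : ℂ) * Complex.exp (-(s : ℂ) ^ 2 / (4 * z)) := by
    have f1 := fourierIntegral_gaussian hz (s : ℂ)
    have f2 := fourierIntegral_gaussian hz (-s : ℂ)
    rw [neg_sq] at f2
    have hj : ∀ c : ℝ, Integrable (fun x : ℝ => Complex.exp (Complex.I * c * x) * Complex.exp (-z * (x : ℂ) ^ 2)) := by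
      intro c
      refine (integrable_cexp_neg_mul_sq hz).bdd_mul (c := 1) (by fun_prop) (Eventually.of_forall fun l => ?_)
      rw [show Complex.I * (c : ℂ) * (l : ℂ) = ((c * l : ℝ) : ℂ) * Complex.I by push_cast; ring, Complex.norm_exp_ofReal_mul_I]
    have hs := integral_add (hj s) (hj (-s))
    push_cast at hs
    rw [f1, f2] at hs
    have : (2 : ℂ) * ∫ l : ℝ, ((Real.cos (l * s) : ℝ) : ℂ) * Complex.exp (-z * (l : ℂ) ^ 2) = 
       2 * ((Real.pi / z) ^ (1 / 2 : ℂ) * Complex.exp (-(s : ℂ) ^ 2 / (4 * z))) := by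
      rw [two_mul (_ * _), ← hs, ← integral_const_mul]
      congr 1; funext l
      rw [Complex.ofReal_cos, ← mul_assoc, Complex.two_cos]
      push_cast
      rw [← add_mul]
      congr 3 <;> ring_nf
    exact mul_left_cancel₀ two_ne_zero this
  have e4 : ∫ l : ℝ, ((l * Real.sin (l * s) : ℝ) : ℂ) * Complex.exp (-z * (l : ℂ) ^ 2) =
     2 * ∫ l in Set.Ioi (0 : ℝ), ((l * Real.sin (l * s) : ℝ) : ℂ) * Complex.exp (-z * (l : ℂ) ^ 2) := by
    have key : ∀ f : ℝ → ℂ, Integrable f → (∀ x, f (-x) = f x) → ∫ x, f x = 2 * ∫ x in Set.Ioi 0, f x := by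
      intro f hf he
      rw [← intervalIntegral.integral_Iic_add_Ioi (b := 0) hf.integrableOn hf.integrableOn, two_mul]
      congr 1
      have := integral_comp_neg_Ioi (0 : ℝ) f
      rw [neg_zero] at this
      rw [← this]
      simp [he]
    refine key _ (i3.congr (Eventually.of_forall fun l => by push_cast; ring)) fun x => ?_
    simp [neg_mul]
  change ∫ l : ℝ, ((Real.sin (l * s) : ℝ) : ℂ) * (Complex.exp (-z * (l : ℂ) ^ 2) * (-z * (2 * (l : ℂ)))) = - ∫ l : ℝ, (((Real.cos (l * s) * s : ℝ)) : ℂ) * Complex.exp (-z * (l : ℂ) ^ 2) at ibp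
  rw [e1, e2, e3, e4] at ibp
  have h4 : 4 * z ≠ 0 := mul_ne_zero (by norm_num) hz0
  rw [div_mul_eq_mul_div, eq_div_iff h4]
  linear_combination (-1 : ℂ) * ibp

noncomputable def Fk (a t s : ℝ) : ℝ :=
  (Real.pi / Real.sqrt (a ^ 2 + t ^ 2)) ^ (1 / 2 : ℝ) / (4 * Real.sqrt (a ^ 2 + t ^ 2)) *
    Real.exp (-(a * s ^ 2 / (4 * (a ^ 2 + t ^ 2))))

lemma Sprop_norm (a : ℝ) (ha : 0 < a) (t s : ℝ) :
    ‖Sprop (gaussS a ha) t s‖ = |s| / |Real.sinh s| * Fk a t s := by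
  set z : ℂ := (a : ℂ) - t * Complex.I with hz
  have hre : z.re = a := by simp [hz]
  have him : z.im = -t := by simp [hz]
  have hnsq : Complex.normSq z = a ^ 2 + t ^ 2 := by
    rw [Complex.normSq_apply, hre, him]; ring
  have hn : ‖z‖ = Real.sqrt (a ^ 2 + t ^ 2) := by
    rw [Complex.norm_def, hnsq]
  have key : Sprop (gaussS a ha) t s = Complex.exp (t * Complex.I) / (Real.sinh s : ℂ) *
      ((s / (4 * z)) * ((Real.pi / z) ^ (1 / 2 : ℂ) * Complex.exp (-(s : ℂ) ^ 2 / (4 * z)))) := by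
    rw [← sin_gauss_integral z (by rw [hre]; exact ha) s, ← integral_const_mul]
    unfold Sprop
    refine setIntegral_congr_fun measurableSet_Ioi fun l hl => ?_
    have hl0 : (l : ℂ) ≠ 0 := by exact_mod_cast (ne_of_gt hl)
    change _ * Complex.exp (-(a : ℂ) * (l : ℂ) ^ 2) * _ = _
    have e : Complex.exp (Complex.I * ((t * (l ^ 2 + 1) : ℝ) : ℂ)) * Complex.exp (-(a : ℂ) * (l : ℂ) ^ 2)
        = Complex.exp (t * Complex.I) * Complex.exp (-z * (l : ℂ) ^ 2) := by
      rw [← Complex.exp_add, ← Complex.exp_add, hz]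
      congr 1; push_cast; ring
    rw [mul_assoc _ (Complex.exp _) (Complex.exp _), e]
    push_cast
    field_simp
  have hexp : ‖Complex.exp (-(s : ℂ) ^ 2 / (4 * z))‖ = Real.exp (-(a * s ^ 2 / (4 * (a ^ 2 + t ^ 2)))) := by
    rw [Complex.norm_exp]
    congr 1
    rw [show -(s : ℂ) ^ 2 / (4 * z) = ((-(s ^ 2) / 4 : ℝ) : ℂ) * z⁻¹ by push_cast; rw [mul_comm 4 z]; ring,
      Complex.re_ofReal_mul, Complex.inv_re, hnsq, hre]
    have : a ^ 2 + t ^ 2 ≠ 0 := by positivity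
    field_simp
  have hpow : ‖((Real.pi : ℂ) / z) ^ (1 / 2 : ℂ)‖ = (Real.pi / Real.sqrt (a ^ 2 + t ^ 2)) ^ (1 / 2 : ℝ) := by
    have := Complex.norm_cpow_real ((Real.pi : ℂ) / z) (1 / 2)
    push_cast at this
    rw [this, norm_div, hn, Complex.norm_real, Real.norm_of_nonneg Real.pi_pos.le]
  rw [key, norm_mul, norm_mul, norm_mul, hexp, hpow, norm_div, norm_div, norm_mul,
    Complex.norm_exp_ofReal_mul_I, Complex.norm_real, Complex.norm_real, hn, Real.norm_eq_abs, Real.norm_eq_abs]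
  unfold Fk
  norm_num
  ring

lemma Fk_nonneg (a t s : ℝ) : 0 ≤ Fk a t s := by unfold Fk; positivity

lemma Fk_le (a t s : ℝ) (ha : 1 ≤ a) (ht0 : 0 < t) (ht1 : t < 1) :
    Fk a t s ≤ Real.exp (-(a / (4 * (a ^ 2 + 1))) * s ^ 2) := by
  have hr : 1 ≤ Real.sqrt (a ^ 2 + t ^ 2) := by
    rw [Real.one_le_sqrt]; nlinarith
  unfold Fk
  set r := Real.sqrt (a ^ 2 + t ^ 2)
  have h1 : (Real.pi / r) ^ (1 / 2 : ℝ) ≤ 2 := by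
    rw [← Real.sqrt_eq_rpow, Real.sqrt_le_left (by norm_num), div_le_iff₀ (by positivity)]
    nlinarith [Real.pi_le_four]
  have h2 : (Real.pi / r) ^ (1 / 2 : ℝ) / (4 * r) ≤ 1 := by
    rw [div_le_one (by positivity)]; linarith
  calc _ ≤ 1 * Real.exp (-(a * s ^ 2 / (4 * (a ^ 2 + t ^ 2)))) := by gcongr
    _ ≤ _ := by
      rw [one_mul, Real.exp_le_exp, neg_mul, neg_le_neg_iff, div_mul_eq_mul_div]
      gcongr
      nlinarith

lemma le_Fk (a t s : ℝ) (ha : 1 ≤ a) (ht0 : 0 < t) (ht1 : t < 1) :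
    1 / (8 * a ^ 2) * Real.exp (-(s ^ 2 / (4 * a))) ≤ Fk a t s := by
  have hr : 1 ≤ Real.sqrt (a ^ 2 + t ^ 2) := by
    rw [Real.one_le_sqrt]; nlinarith
  have hr2 : Real.sqrt (a ^ 2 + t ^ 2) ^ 2 = a ^ 2 + t ^ 2 := Real.sq_sqrt (by positivity)
  unfold Fk
  set r := Real.sqrt (a ^ 2 + t ^ 2)
  have h1 : 1 / r ≤ (Real.pi / r) ^ (1 / 2 : ℝ) := by
    rw [← Real.sqrt_eq_rpow]
    apply Real.le_sqrt_of_sq_le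
    rw [div_pow, div_le_div_iff₀ (by positivity) (by positivity)]
    have := Real.pi_gt_three
    nlinarith [mul_pos (by positivity : 0 < r) (by positivity : 0 < r)]
  have h3 : 1 / (8 * a ^ 2) ≤ (Real.pi / r) ^ (1 / 2 : ℝ) / (4 * r) := by
    calc 1 / (8 * a ^ 2) ≤ 1 / r / (4 * r) := by
          rw [div_div, show r * (4 * r) = 4 * r ^ 2 by ring, hr2]
          apply one_div_le_one_div_of_le (by positivity)
          nlinarith
      _ ≤ _ := by gcongr
  have h4 : Real.exp (-(s ^ 2 / (4 * a))) ≤ Real.exp (-(a * s ^ 2 / (4 * (a ^ 2 + t ^ 2)))) := by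
    rw [Real.exp_le_exp, neg_le_neg_iff, div_le_div_iff₀ (by positivity) (by positivity)]
    nlinarith [mul_nonneg (sq_nonneg s) (sq_nonneg t)]
  exact mul_le_mul h3 h4 (by positivity) (by positivity)

lemma Fk_bdd (a : ℝ) (ha : 1 ≤ a) (s : ℝ) :
    BddAbove (range fun t : Set.Ioo (0 : ℝ) 1 => Fk a t s) := by
  refine ⟨Real.exp (-(a / (4 * (a ^ 2 + 1))) * s ^ 2), ?_⟩
  · rintro _ ⟨t, rfl⟩
    exact Fk_le a t s ha t.2.1 t.2.2

lemma Sstar_eq (a : ℝ) (ha : 0 < a) (s : ℝ) :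
    Sstar (gaussS a ha) s = |s| / |Real.sinh s| * ⨆ t : Set.Ioo (0 : ℝ) 1, Fk a t s := by
  unfold Sstar
  simp_rw [Sprop_norm]
  rw [Real.mul_iSup_of_nonneg (by positivity)]

lemma Sstar_meas (a : ℝ) (ha : 0 < a) (ha1 : 1 ≤ a) : Measurable (Sstar (gaussS a ha)) := by
  have : Sstar (gaussS a ha) = fun s => |s| / |Real.sinh s| * ⨆ t : Set.Ioo (0 : ℝ) 1, Fk a t s :=
    funext (Sstar_eq a ha)
  rw [this]
  have h : Measurable fun s : ℝ => ⨆ t : Set.Ioo (0 : ℝ) 1, Fk a t s := by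
    refine (lowerSemicontinuous_ciSup (Fk_bdd a ha1) fun t => ?_).measurable
    apply Continuous.lowerSemicontinuous
    unfold Fk
    fun_prop
  have h2 : Measurable fun s : ℝ => |s| / |Real.sinh s| :=
    continuous_abs.measurable.div (Real.continuous_sinh.abs.measurable)
  exact h2.mul h

instance : Nonempty (Set.Ioo (0 : ℝ) 1) := ⟨⟨1 / 2, by norm_num, by norm_num⟩⟩

lemma Sstar_nonneg (g : ℝ → ℂ) (s : ℝ) : 0 ≤ Sstar g s :=
  Real.iSup_nonneg fun _ => norm_nonneg _

lemma Sstar_le (a : ℝ) (ha : 0 < a) (ha1 : 1 ≤ a) (s : ℝ) (hs : 0 < s) :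
    Sstar (gaussS a ha) s ≤ Real.exp (-(a / (4 * (a ^ 2 + 1))) * s ^ 2) := by
  rw [Sstar_eq]
  have h1 : |s| / |Real.sinh s| ≤ 1 := by
    apply div_le_one_of_le₀ _ (abs_nonneg _)
    rw [abs_of_pos hs, abs_of_pos (Real.sinh_pos_iff.2 hs)]
    exact (Real.self_lt_sinh_iff.2 hs).le
  have h2 : ⨆ t : Set.Ioo (0 : ℝ) 1, Fk a t s ≤ Real.exp (-(a / (4 * (a ^ 2 + 1))) * s ^ 2) :=
    ciSup_le fun t => Fk_le a t s ha1 t.2.1 t.2.2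
  have h3 : 0 ≤ ⨆ t : Set.Ioo (0 : ℝ) 1, Fk a t s := Real.iSup_nonneg fun t => Fk_nonneg _ _ _
  calc _ ≤ 1 * ⨆ t : Set.Ioo (0 : ℝ) 1, Fk a t s := by gcongr
    _ ≤ _ := by rw [one_mul]; exact h2

lemma le_Sstar (a : ℝ) (ha : 0 < a) (ha1 : 1 ≤ a) (s : ℝ) (hs : 1 ≤ s) :
    1 / (8 * a ^ 2) * Real.exp (-(s ^ 2 / (4 * a))) / Real.sinh s ≤ Sstar (gaussS a ha) s := by
  rw [Sstar_eq]
  have hsh : 0 < Real.sinh s := Real.sinh_pos_iff.2 (by linarith)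
  rw [abs_of_pos (by linarith : 0 < s), abs_of_pos hsh]
  have h := (le_Fk a (1 / 2) s ha1 (by norm_num) (by norm_num)).trans
    (le_ciSup (Fk_bdd a ha1 s) ⟨1 / 2, by norm_num, by norm_num⟩)
  rw [div_mul_eq_mul_div s]
  refine div_le_div_of_nonneg_right ?_ hsh.le
  refine h.trans ?_
  have h3 : 0 ≤ ⨆ t : Set.Ioo (0 : ℝ) 1, Fk a t s := Real.iSup_nonneg fun t => Fk_nonneg _ _ _
  nlinarith

lemma integrand_integrable (a : ℝ) (ha : 0 < a) (ha1 : 1 ≤ a) (q : ℝ) (hq1 : 1 ≤ q) :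
    IntegrableOn (fun s => Sstar (gaussS a ha) s ^ q * Real.sinh s ^ 2) (Set.Ioi 0) := by
  set c : ℝ := a / (4 * (a ^ 2 + 1)) with hc
  have hc0 : 0 < c := by positivity
  have hdom : Integrable (fun s : ℝ => Real.exp (2 / c) * Real.exp (-(c / 2) * s ^ 2)) :=
    (integrable_exp_neg_mul_sq (by positivity)).const_mul _
  refine Integrable.mono' (hdom.integrableOn (s := Set.Ioi 0)) ?_ ?_
  · have := (Sstar_meas a ha ha1).pow_const q
    exact (this.mul (Real.continuous_sinh.measurable.pow_const 2)).aestronglyMeasurable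
  · refine (ae_restrict_iff' measurableSet_Ioi).2 (Eventually.of_forall fun s hs => ?_)
    have hs : 0 < s := hs
    have hle := Sstar_le a ha ha1 s hs
    rw [← hc] at hle
    have h0 := Sstar_nonneg (gaussS a ha) s
    have hle1 : Sstar (gaussS a ha) s ≤ 1 := hle.trans (Real.exp_le_one_iff.2 (by nlinarith [mul_nonneg hc0.le (sq_nonneg s)]))
    have hp : Sstar (gaussS a ha) s ^ q ≤ Sstar (gaussS a ha) s := by
      have := Real.rpow_le_rpow_of_exponent_ge' h0 hle1 (by norm_num) hq1
      simpa using this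
    have hsh0 : 0 < Real.sinh s := Real.sinh_pos_iff.2 hs
    have hsh : Real.sinh s ≤ Real.exp s := by
      rw [Real.sinh_eq]; have := Real.exp_pos (-s); have := Real.exp_pos s; linarith
    have hn := Real.rpow_nonneg h0 q
    rw [Real.norm_of_nonneg (by positivity)]
    calc _ ≤ Real.exp (-c * s ^ 2) * Real.exp s ^ 2 := by
          apply mul_le_mul (hp.trans hle) _ (by positivity) (by positivity)
          gcongr
      _ = Real.exp (-c * s ^ 2 + 2 * s) := by
          rw [Real.exp_add, ← Real.exp_nat_mul]; norm_num
      _ ≤ Real.exp (2 / c + -(c / 2) * s ^ 2) := by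
          rw [Real.exp_le_exp]
          have : 2 / c + -(c / 2) * s ^ 2 - (-c * s ^ 2 + 2 * s) = (c * s - 2) ^ 2 / (2 * c) := by
            field_simp; ring
          have h2 : 0 ≤ (c * s - 2) ^ 2 / (2 * c) := by positivity
          linarith
      _ = _ := by rw [Real.exp_add]

lemma integrand_lower (a : ℝ) (ha : 0 < a) (ha1 : 1 ≤ a) (q : ℝ) (hq1 : 1 ≤ q) (hq2 : q < 2)
    (haq : 1 ≤ (2 - q) * a) (s : ℝ) (hs : s ∈ Set.Icc ((2 - q) * a) ((2 - q) * a + 1)) :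
    (1 / (8 * a ^ 2)) ^ 2 * (Real.exp ((2 - q) ^ 2 * a / 2 - 1 / 2) / 4) ≤
      Sstar (gaussS a ha) s ^ q * Real.sinh s ^ 2 := by
  have hs1 : 1 ≤ s := haq.trans hs.1
  have hsh : 0 < Real.sinh s := Real.sinh_pos_iff.2 (by linarith)
  set κ : ℝ := 1 / (8 * a ^ 2) * Real.exp (-(s ^ 2 / (4 * a))) with hκ
  have hκ0 : 0 < κ := by positivity
  have hκ1 : κ ≤ 1 := by
    have h1 : 1 / (8 * a ^ 2) ≤ 1 := by
      rw [div_le_one (by positivity)]; nlinarith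
    have h2 : Real.exp (-(s ^ 2 / (4 * a))) ≤ 1 := Real.exp_le_one_iff.2 (by
      have : 0 ≤ s ^ 2 / (4 * a) := by positivity
      linarith)
    exact mul_le_one₀ h1 (by positivity) h2
  have h1 : (κ / Real.sinh s) ^ q ≤ Sstar (gaussS a ha) s ^ q :=
    Real.rpow_le_rpow (by positivity) (le_Sstar a ha ha1 s hs1) (by linarith)
  have h2 : κ ^ 2 ≤ κ ^ q := by
    rw [← Real.rpow_natCast]
    exact Real.rpow_le_rpow_of_exponent_ge hκ0 hκ1 (by push_cast; exact hq2.le)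
  have h3 : Real.exp ((2 - q) * s) / 4 ≤ Real.sinh s ^ (2 - q) := by
    have hb : Real.exp s / 4 ≤ Real.sinh s := by
      rw [Real.sinh_eq]
      have e1 : Real.exp (-s) ≤ 1 := Real.exp_le_one_iff.2 (by linarith)
      have e2 := Real.add_one_le_exp s
      linarith
    have hb2 : (Real.exp s / 4) ^ (2 - q) ≤ Real.sinh s ^ (2 - q) :=
      Real.rpow_le_rpow (by positivity) hb (by linarith)
    refine le_trans ?_ hb2
    rw [Real.div_rpow (by positivity) (by norm_num), ← Real.exp_mul, mul_comm s]
    gcongr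
    calc (4 : ℝ) ^ (2 - q) ≤ 4 ^ (1 : ℝ) := Real.rpow_le_rpow_of_exponent_le (by norm_num) (by linarith)
      _ = 4 := by norm_num
  have h4 : (κ / Real.sinh s) ^ q * Real.sinh s ^ 2 = κ ^ q * Real.sinh s ^ (2 - q) := by
    rw [Real.div_rpow hκ0.le hsh.le, Real.rpow_sub hsh]
    norm_num
    ring
  calc _ ≤ κ ^ 2 * (Real.exp ((2 - q) * s) / 4) := by
        rw [hκ, mul_pow, ← Real.exp_nat_mul, mul_assoc, ← mul_div_assoc (Real.exp (_ * _)),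
          ← Real.exp_add]
        gcongr
        push_cast
        have hid : 2 * -(s ^ 2 / (4 * a)) + (2 - q) * s - (2 - q) ^ 2 * a / 2 =
            - ((s - (2 - q) * a) ^ 2 / (2 * a)) := by field_simp; ring
        have hb : (s - (2 - q) * a) ^ 2 / (2 * a) ≤ 1 / 2 := by
          rw [div_le_div_iff₀ (by positivity) (by norm_num)]
          have := hs.1; have := hs.2
          nlinarith
        linarith
    _ ≤ κ ^ q * Real.sinh s ^ (2 - q) := by gcongr
    _ = (κ / Real.sinh s) ^ q * Real.sinh s ^ 2 := h4.symm
    _ ≤ _ := by gcongr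

lemma integral_lower (a : ℝ) (ha : 0 < a) (ha1 : 1 ≤ a) (q : ℝ) (hq1 : 1 ≤ q) (hq2 : q < 2)
    (haq : 1 ≤ (2 - q) * a) :
    (1 / (8 * a ^ 2)) ^ 2 * (Real.exp ((2 - q) ^ 2 * a / 2 - 1 / 2) / 4) ≤
      ∫ s in Set.Ioi (0 : ℝ), Sstar (gaussS a ha) s ^ q * Real.sinh s ^ 2 := by
  have hint := integrand_integrable a ha ha1 q hq1
  have hsub : Set.Icc ((2 - q) * a) ((2 - q) * a + 1) ⊆ Set.Ioi 0 := fun s hs =>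
    lt_of_lt_of_le (by linarith) hs.1
  have h1 := setIntegral_mono_set hint (Eventually.of_forall fun s =>
    mul_nonneg (Real.rpow_nonneg (Sstar_nonneg (gaussS a ha) s) q) (sq_nonneg _)) hsub.eventuallyLE
  refine le_trans ?_ h1
  have h2 := setIntegral_mono_on (μ := volume) (s := Set.Icc ((2 - q) * a) ((2 - q) * a + 1))
    (f := fun _ => (1 / (8 * a ^ 2)) ^ 2 * (Real.exp ((2 - q) ^ 2 * a / 2 - 1 / 2) / 4))
    (integrableOn_const (by simp)) (hint.mono_set hsub) measurableSet_Icc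
    (fun s hs => integrand_lower a ha ha1 q hq1 hq2 haq s hs)
  simpa using h2

lemma sob_le (α : ℝ) (hα : 1 / 2 < α) (a : ℝ) (ha : 0 < a) (haα : α + 1 ≤ a) :
    sobNorm α (gaussS a ha) ≤ (∫ l in Set.Ioi (0 : ℝ), Real.exp (-1 * l ^ 2)) ^ ((1 : ℝ) / 2) := by
  unfold sobNorm
  apply Real.rpow_le_rpow _ _ (by norm_num)
  · exact integral_nonneg fun l => by positivity
  · refine integral_mono_of_nonneg (Eventually.of_forall fun l => by positivity)
      (integrable_exp_neg_mul_sq one_pos).integrableOn (Eventually.of_forall fun l => ?_)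
    have hg : ‖gaussS a ha l‖ = Real.exp (-a * l ^ 2) := norm_gauss a l
    simp only [hg]
    have h1 : (l ^ 2 + 1) ^ α ≤ Real.exp (l ^ 2 * α) := by
      rw [Real.exp_mul]
      exact Real.rpow_le_rpow (by positivity) (Real.add_one_le_exp _) (by linarith)
    have h2 : l ^ 2 ≤ Real.exp (l ^ 2) := by linarith [Real.add_one_le_exp (l ^ 2)]
    calc _ ≤ Real.exp (l ^ 2 * α) * Real.exp (-a * l ^ 2) ^ 2 * Real.exp (l ^ 2) := by gcongr
      _ = Real.exp (l ^ 2 * α + 2 * (-a * l ^ 2) + l ^ 2) := by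
        rw [Real.exp_add, Real.exp_add, ← Real.exp_nat_mul]; norm_num
      _ ≤ _ := by
        rw [Real.exp_le_exp]
        nlinarith [mul_nonneg (sq_nonneg l) (by linarith : 0 ≤ a - (α + 1)), mul_nonneg (sq_nonneg l) (by linarith : 0 ≤ a - 1)]

/-- Theorem 1.2 on `ℍ³`, negative part: for every `α > 1/2` the global `L^q`
maximal estimate fails for every `q ∈ [1, 2)`. -/
theorem schrodinger_maximal_global_fails_below_L2
    (α : ℝ) (hα : 1 / 2 < α) (q : ℝ) (hq1 : 1 ≤ q) (hq2 : q < 2) :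
    ¬ ∃ C : ℝ, 0 < C ∧ ∀ g : SchwartzMap ℝ ℂ, (∀ x, g (-x) = g x) →
      (∫ s in Set.Ioi (0 : ℝ), (Sstar ⇑g s) ^ q * Real.sinh s ^ 2) ^ (1 / q)
        ≤ C * sobNorm α ⇑g := by
  rintro ⟨C, hC, H⟩
  set K : ℝ := (∫ l in Set.Ioi (0 : ℝ), Real.exp (-1 * l ^ 2)) ^ ((1 : ℝ) / 2) with hK
  set δ : ℝ := 2 - q with hδ
  have hδ0 : 0 < δ := by linarith
  set M : ℝ := (C * K) ^ q with hM
  set c : ℝ := Real.exp (-(1 / 2)) * (δ ^ 2 / 2) ^ 5 / (120 * 256) with hc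
  have hc0 : 0 < c := by positivity
  obtain ⟨a, h1, h2, h3⟩ : ∃ a : ℝ, α + 1 ≤ a ∧ 1 / δ ≤ a ∧ (M + 1) / c ≤ a :=
    ⟨max (α + 1) (max (1 / δ) ((M + 1) / c)), le_max_left _ _,
      (le_max_left _ _).trans (le_max_right _ _), (le_max_right _ _).trans (le_max_right _ _)⟩
  have ha1 : 1 ≤ a := by linarith
  have ha : 0 < a := by linarith
  have haq : 1 ≤ (2 - q) * a := by
    rw [div_le_iff₀ hδ0] at h2; rw [← hδ]; linarith
  have hl := integral_lower a ha ha1 q hq1 hq2 haq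
  have hH := H (gaussS a ha) (fun x => by
    change Complex.exp (-(a : ℂ) * ((-x : ℝ) : ℂ) ^ 2) = Complex.exp (-(a : ℂ) * (x : ℂ) ^ 2)
    push_cast; rw [neg_sq])
  set I : ℝ := ∫ s in Set.Ioi (0 : ℝ), Sstar (gaussS a ha) s ^ q * Real.sinh s ^ 2 with hI
  have hI0 : 0 ≤ I := le_trans (by positivity) hl
  have hH2 : I ^ (1 / q) ≤ C * K :=
    hH.trans (mul_le_mul_of_nonneg_left (sob_le α hα a ha h1) hC.le)
  have hIM : I ≤ M := by
    have := Real.rpow_le_rpow (by positivity) hH2 (by linarith : 0 ≤ q)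
    rwa [← Real.rpow_mul hI0, one_div_mul_cancel (by linarith), Real.rpow_one] at this
  have hca : c * a ≤ I := by
    refine le_trans ?_ hl
    rw [← hδ]
    have hp := Real.pow_div_factorial_le_exp (δ ^ 2 * a / 2) (by positivity) 5
    rw [show δ ^ 2 * a / 2 - 1 / 2 = δ ^ 2 * a / 2 + -(1 / 2) by ring, Real.exp_add]
    calc c * a = (1 / (8 * a ^ 2)) ^ 2 * ((δ ^ 2 * a / 2) ^ 5 / (Nat.factorial 5 : ℝ) * Real.exp (-(1 / 2)) / 4) := by
          rw [hc]
          norm_num [Nat.factorial]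
          field_simp
          norm_num
      _ ≤ _ := by gcongr
  rw [div_le_iff₀ hc0] at h3
  linarith
end

section
/- (Failure of the local borderline fractional Sobolev embedding on ℍ³, Remark 5.1.) For every R > 0 there is no constant C > 0 such that for all even Schwartz functions g : ℝ → ℂ one has ess sup_{0<s<R} | ∫₀^∞ g(λ) (sin(λs)/(λ sinh s)) λ² dλ | ≤ C ( ∫₀^∞ (λ²+1)^{3/2} |g(λ)|² λ² dλ )^{1/2}; that is, the embedding ‖f‖_{L^∞(B_R)} ≲ ‖f‖_{H^{n/2}(ℍ³)} (with n = 3) fails on every geodesic ball centered at the identity. -/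
open MeasureTheory Filter Set ENNReal

noncomputable section

/-- The inverse spherical Fourier transform on `ℍ³` (up to a fixed positive
constant): the radial function with spherical Fourier transform `g`. -/
def invSFT (g : ℝ → ℂ) (s : ℝ) : ℂ :=
  ∫ l in Set.Ioi (0 : ℝ),
    g l * ((Real.sin (l * s) / (l * Real.sinh s) : ℝ) : ℂ) * ((l : ℂ) ^ 2)

end


lemma sfe_sinh_le {s : ℝ} (h0 : 0 < s) (h1 : s ≤ 1) : Real.sinh s ≤ 3 / 2 * s := by
  have h2 := Real.abs_exp_sub_one_le (x := s) (by rw [abs_of_pos h0]; exact h1)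
  rw [abs_of_pos h0] at h2
  have h3 := (abs_le.mp h2).2
  have h4 := Real.add_one_le_exp (-s)
  rw [Real.sinh_eq]
  linarith

lemma sfe_kernel {l s M : ℝ} (hl : 0 < l) (hlM : l ≤ M) (h0 : 0 < s) (h1 : s ≤ 1)
    (h2 : s * M ≤ 1) : 1 / 2 * l ^ 2 ≤ l * Real.sin (l * s) / Real.sinh s := by
  have hls : 0 < l * s := mul_pos hl h0
  have hls1 : l * s ≤ 1 := by nlinarith
  have h3 := Real.sin_gt_sub_cube hls
  have h4 := sfe_sinh_le h0 h1
  have h5 : 0 < Real.sinh s := Real.sinh_pos_iff.mpr h0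
  have h6 : 3 / 4 * (l * s) ≤ Real.sin (l * s) := by
    nlinarith [mul_le_one₀ hls1 hls.le hls1, mul_pos hls hls]
  rw [le_div_iff₀ h5]
  calc 1 / 2 * l ^ 2 * Real.sinh s ≤ 1 / 2 * l ^ 2 * (3 / 2 * s) := by gcongr
    _ = l * (3 / 4 * (l * s)) := by ring
    _ ≤ _ := by gcongr

lemma sfe_low {l : ℝ} (hl : 1 ≤ l) : 1 / 3 * l⁻¹ ≤ (l ^ 2 + 1) ^ (-(3 / 2) : ℝ) * l ^ 2 := by
  have hp : 0 < l := by linarith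
  have hw : 0 < l ^ 2 + 1 := by positivity
  have h1 : (l ^ 2 + 1) ^ (3 / 2 : ℝ) ≤ 3 * l ^ 3 := by
    have h2 : ((l ^ 2 + 1) ^ (3 / 2 : ℝ)) ^ 2 = (l ^ 2 + 1) ^ 3 := by
      rw [← Real.rpow_natCast, ← Real.rpow_mul hw.le, ← Real.rpow_natCast]; norm_num
    apply le_of_sq_le_sq _ (by positivity) 
    rw [h2]
    calc (l ^ 2 + 1) ^ 3 ≤ (2 * l ^ 2) ^ 3 := by gcongr; nlinarith
      _ ≤ (3 * l ^ 3) ^ 2 := by nlinarith [pow_pos hp 6]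
  rw [Real.rpow_neg hw.le]
  have h3 : (3 * l ^ 3)⁻¹ ≤ ((l ^ 2 + 1) ^ (3 / 2 : ℝ))⁻¹ := by gcongr
  calc 1 / 3 * l⁻¹ = (3 * l ^ 3)⁻¹ * l ^ 2 := by field_simp
    _ ≤ _ := by gcongr

lemma sfe_main (N : ℝ) (hN : 1 ≤ N) : ∃ (g : SchwartzMap ℝ ℂ) (A : ℝ), (∀ x, g (-x) = g x) ∧
    1 / 3 * Real.log N ≤ A ∧ sobNorm (3 / 2) ⇑g ≤ A ^ ((1 : ℝ) / 2) ∧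
    ∀ s, 0 < s → s ≤ 1 → s * (N + 1) ≤ 1 → 1 / 2 * A ≤ ‖invSFT ⇑g s‖ := by
  let χ : ContDiffBump (0 : ℝ) := ⟨N, N + 1, by linarith, by linarith⟩
  let h : ℝ → ℝ := fun l => (l ^ 2 + 1) ^ (-(3 / 2) : ℝ)
  have hw : ∀ l : ℝ, 0 < l ^ 2 + 1 := fun l => by positivity
  have hh : ContDiff ℝ (⊤ : ℕ∞) h := by
    apply ContDiff.rpow_const_of_ne (by fun_prop)
    intro l; exact (hw l).ne'
  have hh0 : ∀ l, 0 < h l := fun l => Real.rpow_pos_of_pos (hw l) _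
  have hχ : ContDiff ℝ (⊤ : ℕ∞) (fun x => χ x) := χ.contDiff
  have hχs : HasCompactSupport (fun x => χ x) := χ.hasCompactSupport
  let r : ℝ → ℝ := fun l => χ l * h l
  have hr : ContDiff ℝ (⊤ : ℕ∞) r := hχ.mul hh
  have hrs : HasCompactSupport r := hχs.mul_right
  have hr0 : ∀ l, 0 ≤ r l := fun l => mul_nonneg χ.nonneg (hh0 l).le
  have hgs : HasCompactSupport (fun l => (r l : ℂ)) := hrs.comp_left (g := fun x : ℝ => (x : ℂ)) (by simp)
  have hgc : ContDiff ℝ (⊤ : ℕ∞) (fun l => (r l : ℂ)) := Complex.ofRealCLM.contDiff.comp hr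
  have hIntg : ∀ k : ℝ → ℝ, Continuous k → Integrable (fun l => r l * k l) := fun k hk =>
    (hr.continuous.mul hk).integrable_of_hasCompactSupport hrs.mul_right
  have hone : ∀ l, 0 ≤ l → l ≤ N → χ l = 1 := by
    intro l h0 h1
    apply χ.one_of_mem_closedBall
    rw [mem_closedBall_zero_iff, Real.norm_of_nonneg h0]; exact h1
  have hzero : ∀ l, N + 1 ≤ l → χ l = 0 := by
    intro l h1
    apply χ.zero_of_le_dist
    rw [Real.dist_0_eq_abs]; exact h1.trans (le_abs_self l)
  refine ⟨hgs.toSchwartzMap hgc, ∫ l in Ioi (0 : ℝ), r l * l ^ 2, ?_, ?_, ?_, ?_⟩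
  · intro x
    change ((χ (-x) * h (-x) : ℝ) : ℂ) = ((χ x * h x : ℝ) : ℂ)
    rw [χ.neg]; simp [h]
  · have e : 1 / 3 * Real.log N = ∫ l in Ioc 1 N, 1 / 3 * l⁻¹ := by
      rw [← intervalIntegral.integral_of_le hN, intervalIntegral.integral_const_mul,
        integral_inv_of_pos one_pos (by linarith), div_one]
    rw [e]
    calc ∫ l in Ioc 1 N, 1 / 3 * l⁻¹ ≤ ∫ l in Ioc 1 N, r l * l ^ 2 := by
          apply setIntegral_mono_on _ _ measurableSet_Ioc
          · intro l hl
            simp only [r]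
            rw [hone l (by linarith [hl.1]) hl.2, one_mul]
            exact sfe_low hl.1.le
          · apply Integrable.const_mul
            rw [← IntegrableOn, ← intervalIntegrable_iff_integrableOn_Ioc_of_le hN]
            apply intervalIntegral.intervalIntegrable_inv _ continuousOn_id
            intro x hx
            rw [uIcc_of_le hN] at hx
            simp only [id]
            linarith [hx.1]
          · exact (hIntg _ (by fun_prop)).integrableOn
      _ ≤ _ := by
          apply setIntegral_mono_set (hIntg _ (by fun_prop)).integrableOn
          · exact Eventually.of_forall fun l => mul_nonneg (hr0 l) (sq_nonneg l)
          · apply HasSubset.Subset.eventuallyLE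
            intro l hl
            exact lt_trans one_pos hl.1
  · unfold sobNorm
    change (∫ l in Ioi (0 : ℝ), (l ^ 2 + 1) ^ (3 / 2 : ℝ) * ‖(r l : ℂ)‖ ^ 2 * l ^ 2) ^ ((1 : ℝ) / 2) ≤ _
    have e : ∀ l, (l ^ 2 + 1) ^ (3 / 2 : ℝ) * ‖(r l : ℂ)‖ ^ 2 * l ^ 2 = r l * (χ l * l ^ 2) := by
      intro l
      have : (l ^ 2 + 1) ^ (3 / 2 : ℝ) * h l = 1 := by
        simp only [h]
        rw [← Real.rpow_add (hw l)]; norm_num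
      rw [Complex.norm_real, Real.norm_eq_abs, sq_abs]
      simp only [r]
      linear_combination (χ l ^ 2 * h l * l ^ 2) * this
    simp only [e]
    apply Real.rpow_le_rpow _ _ (by norm_num)
    · exact integral_nonneg fun l => mul_nonneg (hr0 l) (mul_nonneg χ.nonneg (sq_nonneg l))
    · apply integral_mono (hIntg _ (hχ.continuous.mul (by fun_prop))).integrableOn
        (hIntg _ (by fun_prop)).integrableOn
      intro l
      exact mul_le_mul_of_nonneg_left (mul_le_of_le_one_left (sq_nonneg l) χ.le_one) (hr0 l)
  · intro s h0 h1 h2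
    have e : invSFT ⇑(hgs.toSchwartzMap hgc) s
        = ((∫ l in Ioi (0 : ℝ), r l * (l * Real.sin (l * s) / Real.sinh s) : ℝ) : ℂ) := by
      unfold invSFT
      rw [← integral_complex_ofReal]
      apply setIntegral_congr_fun measurableSet_Ioi
      intro l hl
      have hl : (0 : ℝ) < l := hl
      change (r l : ℂ) * ((Real.sin (l * s) / (l * Real.sinh s) : ℝ) : ℂ) * ((l : ℂ) ^ 2) = _
      norm_cast
      have h5 : 0 < Real.sinh s := Real.sinh_pos_iff.mpr h0
      field_simp
    rw [e, Complex.norm_real]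
    refine le_trans ?_ (Real.le_norm_self _)
    rw [← integral_const_mul]
    apply setIntegral_mono_on ((hIntg _ (by fun_prop)).const_mul _).integrableOn
      (hIntg _ (by fun_prop)).integrableOn measurableSet_Ioi
    intro l hl
    have hl : (0 : ℝ) < l := hl
    rcases le_total l (N + 1) with h3 | h3
    · have := mul_le_mul_of_nonneg_left (sfe_kernel hl h3 h0 h1 h2) (hr0 l)
      linarith
    · simp [r, hzero l h3]

/-- Remark 5.1 on `ℍ³`: the local borderline fractional Sobolev embedding
`‖f‖_{L^∞(B_R)} ≲ ‖f‖_{H^{3/2}}` fails on every geodesic ball. -/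
theorem borderline_sobolev_embedding_fails (R : ℝ) (hR : 0 < R) :
    ¬ ∃ C : ℝ, 0 < C ∧ ∀ g : SchwartzMap ℝ ℂ, (∀ x, g (-x) = g x) →
      eLpNorm (invSFT ⇑g) ⊤ (volume.restrict (Set.Ioo 0 R))
        ≤ ENNReal.ofReal (C * sobNorm (3 / 2) ⇑g) := by
  rintro ⟨C, hC, H⟩
  set N : ℝ := Real.exp (3 * (4 * C ^ 2 + 1)) with hNdef
  have hN : 1 ≤ N := Real.one_le_exp (by positivity)
  obtain ⟨g, A, hg, hA, hS, hI⟩ := sfe_main N hN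
  rw [hNdef, Real.log_exp] at hA
  have hA' : 4 * C ^ 2 + 1 ≤ A := by linarith
  have hA0 : 0 < A := by nlinarith [sq_nonneg C]
  have hle := H g hg
  have hae : ∀ᵐ s ∂(volume.restrict (Set.Ioo 0 R)), ‖invSFT ⇑g s‖ ≤ C * A ^ ((1 : ℝ) / 2) := by
    rw [eLpNorm_exponent_top] at hle
    filter_upwards [enorm_ae_le_eLpNormEssSup (invSFT ⇑g) (volume.restrict (Set.Ioo 0 R))] with s hs
    have h1 : ‖invSFT ⇑g s‖ₑ ≤ ENNReal.ofReal (C * A ^ ((1 : ℝ) / 2)) :=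
      (hs.trans hle).trans (ENNReal.ofReal_le_ofReal (by gcongr))
    rw [← ofReal_norm_eq_enorm] at h1
    exact (ENNReal.ofReal_le_ofReal_iff (by positivity)).mp h1
  set δ : ℝ := min R (1 / (N + 1)) with hδ
  have hδ0 : 0 < δ := lt_min hR (by positivity)
  have hsub : Set.Ioo 0 δ ⊆ Set.Ioo 0 R := Set.Ioo_subset_Ioo_right (min_le_left _ _)
  have hae2 := ae_restrict_of_ae_restrict_of_subset hsub hae
  have hne : (volume.restrict (Set.Ioo 0 δ)) ≠ 0 := by
    rw [Ne, Measure.restrict_eq_zero, Real.volume_Ioo]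
    simpa using hδ0
  have : NeBot (ae (volume.restrict (Set.Ioo 0 δ))) := ae_neBot.mpr hne
  obtain ⟨s, hs1, hs2⟩ := (hae2.and (ae_restrict_mem measurableSet_Ioo)).exists
  have hs3 : s ≤ 1 / (N + 1) := hs2.2.le.trans (min_le_right _ _)
  have hs4 : s * (N + 1) ≤ 1 := (le_div_iff₀ (by positivity)).mp hs3
  have hs5 : s ≤ 1 := by nlinarith [hs2.1]
  have hfin := (hI s hs2.1 hs5 hs4).trans hs1
  rw [← Real.sqrt_eq_rpow] at hfin
  have hq := Real.sq_sqrt hA0.le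
  have hqp := Real.sqrt_pos.mpr hA0
  have : Real.sqrt A ≤ 2 * C := by nlinarith
  nlinarith
end

section
/- (Pointwise exponential decay away from the origin on ℍ³.) For every α > 1/2 there is a constant C = C(α) > 0 such that for every even Schwartz function g : ℝ → ℂ, every t ∈ ℝ and every s ≥ 1, |S_t g(s)| ≤ C e^{−s} ‖g‖_{H^α}; in particular S*g(s) ≤ C e^{−s} ‖g‖_{H^α} for all s ≥ 1. -/
open MeasureTheory Filter Set ENNReal

lemma aux_bound (α : ℝ) (hα : 1 / 2 < α) (g : SchwartzMap ℝ ℂ) :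
    IntegrableOn (fun l : ℝ => l * ‖g l‖) (Set.Ioi 0) ∧
    ∫ l in Set.Ioi (0 : ℝ), l * ‖g l‖ ≤
      sobNorm α g * (∫ l in Set.Ioi (0 : ℝ), (1 + ‖l‖ ^ 2) ^ (-(2 * α) / 2)) ^ ((1 : ℝ) / 2) := by
  have htg : Function.HasTemperateGrowth (fun l : ℝ => (1 + ‖l‖ ^ 2) ^ (α / 2) * l) := by
    fun_prop
  set h := SchwartzMap.smulLeftCLM ℂ (fun l : ℝ => (1 + ‖l‖ ^ 2) ^ (α / 2) * l) g with hh
  have hx : ∀ l : ℝ, 0 < 1 + ‖l‖ ^ 2 := fun l => by positivity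
  have happ : ∀ l : ℝ, 0 < l → ‖h l‖ = (1 + ‖l‖ ^ 2) ^ (α / 2) * l * ‖g l‖ := by
    intro l hl
    rw [hh, SchwartzMap.smulLeftCLM_apply_apply htg, norm_smul, Real.norm_of_nonneg]
    have := Real.rpow_nonneg (hx l).le (α / 2)
    positivity
  have hm1 : MemLp (fun l => ‖h l‖) (ENNReal.ofReal 2) (volume.restrict (Set.Ioi (0 : ℝ))) :=
    ((h.memLp (ENNReal.ofReal 2) volume).norm).restrict _
  have hsq : ∀ l : ℝ, ((1 + ‖l‖ ^ 2) ^ (-α / 2)) ^ 2 = (1 + ‖l‖ ^ 2) ^ (-(2 * α) / 2) := by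
    intro l
    rw [← Real.rpow_mul_natCast (hx l).le]
    congr 1
    push_cast
    ring
  have hm2 : MemLp (fun l : ℝ => (1 + ‖l‖ ^ 2) ^ (-α / 2)) (ENNReal.ofReal 2)
      (volume.restrict (Set.Ioi (0 : ℝ))) := by
    have hms : Measurable (fun l : ℝ => (1 + ‖l‖ ^ 2) ^ (-α / 2)) := by fun_prop
    have : MemLp (fun l : ℝ => (1 + ‖l‖ ^ 2) ^ (-α / 2)) 2 volume := by
      rw [memLp_two_iff_integrable_sq hms.aestronglyMeasurable]
      simp_rw [hsq]
      exact integrable_rpow_neg_one_add_norm_sq (by simp; linarith)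
    simpa using this.restrict _
  have hprod : ∀ l ∈ Set.Ioi (0 : ℝ), ‖h l‖ * (1 + ‖l‖ ^ 2) ^ (-α / 2) = l * ‖g l‖ := by
    intro l hl
    rw [happ l hl]
    have : (1 + ‖l‖ ^ 2) ^ (α / 2) * (1 + ‖l‖ ^ 2) ^ (-α / 2) = 1 := by
      rw [← Real.rpow_add (hx l)]
      simp [neg_div]
    linear_combination (l * ‖g l‖) * this
  constructor
  · have hi : Integrable (fun l => ‖h l‖ * (1 + ‖l‖ ^ 2) ^ (-α / 2))
        (volume.restrict (Set.Ioi (0 : ℝ))) := by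
      rw [show ENNReal.ofReal 2 = 2 by simp] at hm1 hm2
      exact hm1.integrable_mul hm2
    exact IntegrableOn.congr_fun hi hprod measurableSet_Ioi
  · have key := integral_mul_le_Lp_mul_Lq_of_nonneg (p := 2) (q := 2)
      (μ := volume.restrict (Set.Ioi (0 : ℝ))) Real.HolderConjugate.two_two
      (Filter.Eventually.of_forall fun l => norm_nonneg (h l))
      (Filter.Eventually.of_forall fun l : ℝ => Real.rpow_nonneg (hx l).le (-α / 2)) hm1 hm2
    rw [setIntegral_congr_fun measurableSet_Ioi hprod] at key
    refine key.trans (le_of_eq ?_)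
    unfold sobNorm
    congr 2
    · refine setIntegral_congr_fun measurableSet_Ioi fun l hl => ?_
      simp only [Real.rpow_two]
      rw [happ l hl, mul_pow, mul_pow, ← Real.rpow_mul_natCast (hx l).le]
      simp only [Real.norm_eq_abs, sq_abs]
      rw [show α / 2 * ((2 : ℕ) : ℝ) = α by push_cast; ring, add_comm 1 (l ^ 2)]
      ring
    · refine setIntegral_congr_fun measurableSet_Ioi fun l hl => ?_
      simp only [Real.rpow_two]
      exact hsq l

lemma aux_sinh (s : ℝ) (hs : 1 ≤ s) : 0 < Real.sinh s ∧ 1 / Real.sinh s ≤ 4 * Real.exp (-s) := by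
  have h1 : 0 < Real.sinh s := Real.sinh_pos_iff.2 (by linarith)
  refine ⟨h1, ?_⟩
  rw [div_le_iff₀ h1, Real.sinh_eq]
  have h2 : Real.exp (-s) * Real.exp s = 1 := by rw [← Real.exp_add]; simp
  have h3 : 2 ≤ Real.exp s := by linarith [Real.add_one_le_exp s]
  have h4 : 0 < Real.exp (-s) := Real.exp_pos _
  have h5 : Real.exp (-s) ≤ 1 / 2 := by nlinarith
  nlinarith

/-- Pointwise exponential decay away from the origin on `ℍ³`: for `α > 1/2`
one has `|S_t g(s)| ≤ C e^{-s} ‖g‖_{H^α}` for all `t ∈ ℝ` and `s ≥ 1`, and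
hence the same bound for `S* g`. -/
theorem schrodinger_pointwise_decay (α : ℝ) (hα : 1 / 2 < α) :
    ∃ C : ℝ, 0 < C ∧ ∀ g : SchwartzMap ℝ ℂ, (∀ x, g (-x) = g x) →
      (∀ t : ℝ, ∀ s : ℝ, 1 ≤ s →
        ‖Sprop ⇑g t s‖ ≤ C * Real.exp (-s) * sobNorm α ⇑g) ∧
      (∀ s : ℝ, 1 ≤ s → Sstar ⇑g s ≤ C * Real.exp (-s) * sobNorm α ⇑g) := by
  set K := (∫ l in Set.Ioi (0 : ℝ), (1 + ‖l‖ ^ 2) ^ (-(2 * α) / 2)) ^ ((1 : ℝ) / 2) with hK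
  have hK0 : 0 ≤ K := by
    refine Real.rpow_nonneg (integral_nonneg fun l => Real.rpow_nonneg ?_ _) _
    positivity
  refine ⟨4 * K + 1, by positivity, fun g _ => ?_⟩
  have hS0 : 0 ≤ sobNorm α g := by
    refine Real.rpow_nonneg (integral_nonneg fun l => ?_) _
    have : 0 ≤ (l ^ 2 + 1) ^ α := Real.rpow_nonneg (by positivity) _
    positivity
  have main : ∀ t s : ℝ, 1 ≤ s →
      ‖Sprop ⇑g t s‖ ≤ (4 * K + 1) * Real.exp (-s) * sobNorm α ⇑g := by
    intro t s hs
    obtain ⟨hi, hb⟩ := aux_bound α hα g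
    obtain ⟨hp, hle⟩ := aux_sinh s hs
    have h1 : ‖Sprop ⇑g t s‖ ≤ ∫ l in Set.Ioi (0 : ℝ), (1 / Real.sinh s) * (l * ‖g l‖) := by
      refine norm_integral_le_of_norm_le (Integrable.const_mul hi _) ?_
      refine (ae_restrict_iff' measurableSet_Ioi).2 (Filter.Eventually.of_forall fun l hl => ?_)
      have hl : 0 < l := hl
      have he : ‖Complex.exp (Complex.I * ((t * (l ^ 2 + 1) : ℝ) : ℂ))‖ = 1 := by
        rw [mul_comm, Complex.norm_exp_ofReal_mul_I]
      rw [norm_mul, norm_mul, norm_mul, he, Complex.norm_real, norm_pow, Complex.norm_real,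
        Real.norm_of_nonneg hl.le, norm_div, Real.norm_of_nonneg (mul_pos hl hp).le]
      have hsin : ‖Real.sin (l * s)‖ ≤ 1 := Real.abs_sin_le_one _
      calc _ = ‖Real.sin (l * s)‖ * ((1 / Real.sinh s) * (l * ‖g l‖)) := by field_simp
        _ ≤ 1 * ((1 / Real.sinh s) * (l * ‖g l‖)) := by gcongr
        _ = _ := one_mul _
    rw [integral_const_mul] at h1
    have he := Real.exp_pos (-s)
    calc _ ≤ _ := h1
      _ ≤ (4 * Real.exp (-s)) * (sobNorm α g * K) := by
        refine mul_le_mul hle hb ?_ (by positivity)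
        refine setIntegral_nonneg measurableSet_Ioi fun l hl => ?_
        exact mul_nonneg (le_of_lt hl) (norm_nonneg _)
      _ ≤ _ := by
        have : 0 ≤ Real.exp (-s) * sobNorm α g := by positivity
        nlinarith
  refine ⟨main, fun s hs => ?_⟩
  have : Nonempty (Set.Ioo (0 : ℝ) 1) := ⟨⟨1 / 2, by norm_num, by norm_num⟩⟩
  exact ciSup_le fun t => main t s hs
end

section
/- (Sharpness construction of Case 2 on ℍ³.) Let ψ : ℝ → [0,∞) be a smooth function, not identically zero, whose support is contained in (1,2). For N ∈ ℕ define g_N(s) = ∫₀^∞ ψ(λ/N) (sin(λs)/(λ sinh s)) λ² dλ for s > 0. Then: (a) for every α ≥ 0 there is a constant C > 0 such that ( ∫₀^∞ (λ²+1)^α ψ(λ/N)² λ² dλ )^{1/2} ≤ C N^{α+3/2} for all N ∈ ℕ; and (b) there exist ε ∈ (0, 1/2), c > 0 and N₀ ∈ ℕ such that |g_N(s)| ≥ c N³ for all N ≥ N₀ and all s with 0 < s < ε/N. -/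
open MeasureTheory Filter Set ENNReal

/-- Sharpness construction of Case 2 on `ℍ³`: for a smooth nonnegative bump `ψ`
supported in `(1,2)`, the dilated functions `λ ↦ ψ(λ/N)` (spherical Fourier
transforms of radial functions `g_N` on `ℍ³`) satisfy
(a) `‖g_N‖_{H^α} ≤ C N^{α+3/2}`, and
(b) `|g_N(s)| ≥ c N³` on a small ball `0 < s < ε/N` for all large `N`. -/
theorem sharpness_case_two_construction
    (ψ : ℝ → ℝ) (hsm : ContDiff ℝ (⊤ : ℕ∞) ψ) (hnn : ∀ x, 0 ≤ ψ x) (hne : ψ ≠ 0)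
    (hsupp : ∀ x : ℝ, x ∉ Set.Ioo (1 : ℝ) 2 → ψ x = 0) :
    (∀ α : ℝ, 0 ≤ α → ∃ C : ℝ, 0 < C ∧ ∀ N : ℕ, 1 ≤ N →
      (∫ l in Set.Ioi (0 : ℝ), (l ^ 2 + 1) ^ α * (ψ (l / N)) ^ 2 * l ^ 2) ^ ((1 : ℝ) / 2)
        ≤ C * (N : ℝ) ^ (α + 3 / 2)) ∧
    (∃ ε : ℝ, ε ∈ Set.Ioo (0 : ℝ) (1 / 2) ∧ ∃ c : ℝ, 0 < c ∧ ∃ N₀ : ℕ,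
      ∀ N : ℕ, N₀ ≤ N → ∀ s : ℝ, 0 < s → s < ε / N →
        c * (N : ℝ) ^ 3 ≤
          |∫ l in Set.Ioi (0 : ℝ),
            ψ (l / N) * (Real.sin (l * s) / (l * Real.sinh s)) * l ^ 2|) := by
  have hc : Continuous ψ := hsm.continuous
  have hcs : HasCompactSupport ψ := by
    apply HasCompactSupport.intro (isCompact_Icc (a := (1:ℝ)) (b := 2))
    intro x hx
    exact hsupp x (fun h => hx (Ioo_subset_Icc_self h))
  have hz : ∀ N : ℕ, 1 ≤ N → ∀ l : ℝ, l ∉ Set.Icc (N:ℝ) (2 * N) → ψ (l / N) = 0 := by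
    intro N hN l hl
    have hN' : (0:ℝ) < N := by exact_mod_cast hN
    apply hsupp
    rintro ⟨h1, h2⟩
    rw [lt_div_iff₀ hN'] at h1
    rw [div_lt_iff₀ hN'] at h2
    exact hl ⟨by linarith, h2.le⟩
  have hsub : ∀ N : ℕ, 1 ≤ N → Set.Icc (N:ℝ) (2 * N) ⊆ Set.Ioi 0 := by
    intro N hN l hl
    have hN' : (0:ℝ) < N := by exact_mod_cast hN
    exact lt_of_lt_of_le hN' hl.1
  constructor
  · intro α hα
    obtain ⟨M, hM⟩ := hcs.exists_bound_of_continuous hc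
    have hM0 : 0 ≤ M := le_trans (norm_nonneg _) (hM 0)
    refine ⟨((5:ℝ) ^ α * M ^ 2 * 4 + 1) ^ ((1:ℝ) / 2), by positivity, ?_⟩
    intro N hN
    have hN' : (1:ℝ) ≤ N := by exact_mod_cast hN
    have hN0 : (0:ℝ) < N := by linarith
    have e1 : (∫ l in Set.Ioi (0 : ℝ), (l ^ 2 + 1) ^ α * (ψ (l / N)) ^ 2 * l ^ 2)
        = ∫ l in Set.Icc (N:ℝ) (2 * N), (l ^ 2 + 1) ^ α * (ψ (l / N)) ^ 2 * l ^ 2 := by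
      apply setIntegral_eq_of_subset_of_forall_sdiff_eq_zero measurableSet_Ioi (hsub N hN)
      intro x hx
      simp [hz N hN x hx.2]
    have e2 : ‖∫ l in Set.Icc (N:ℝ) (2 * N), (l ^ 2 + 1) ^ α * (ψ (l / N)) ^ 2 * l ^ 2‖
        ≤ ((5 * (N:ℝ) ^ 2) ^ α * M ^ 2 * (2 * N) ^ 2) * volume.real (Set.Icc (N:ℝ) (2 * N)) := by
      apply norm_setIntegral_le_of_norm_le_const
      · exact isCompact_Icc.measure_lt_top
      · intro x hx
        have hx0 : 0 < x := lt_of_lt_of_le hN0 hx.1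
        rw [Real.norm_of_nonneg (by positivity)]
        have h1 : ψ (x / N) ≤ M := le_trans (le_abs_self _) (hM _)
        have h2 := hnn (x / N)
        have h3 : x ≤ 2 * N := hx.2
        have h4 : x ^ 2 + 1 ≤ 5 * (N:ℝ) ^ 2 := by nlinarith
        gcongr
    rw [Real.volume_real_Icc_of_le (by linarith)] at e2
    rw [e1]
    have e3 : ((5 * (N:ℝ) ^ 2) ^ α * M ^ 2 * (2 * N) ^ 2) * (2 * N - N)
        ≤ ((5:ℝ) ^ α * M ^ 2 * 4 + 1) * (N:ℝ) ^ (2 * α + 3) := by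
      have : (N:ℝ) ^ (2 * α + 3) = ((N:ℝ) ^ 2) ^ α * (N:ℝ) ^ 3 := by
        rw [Real.rpow_add hN0, Real.rpow_mul hN0.le]
        norm_num
      rw [this, Real.mul_rpow (by norm_num) (by positivity)]
      have : 0 ≤ ((N:ℝ) ^ 2) ^ α * (N:ℝ) ^ 3 := by positivity
      nlinarith
    have e4 : (N:ℝ) ^ (α + 3 / 2) = ((N:ℝ) ^ (2 * α + 3)) ^ ((1:ℝ) / 2) := by
      rw [← Real.rpow_mul hN0.le]
      congr 1
      ring
    rw [e4, ← Real.mul_rpow (by positivity) (by positivity)]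
    apply Real.rpow_le_rpow _ _ (by norm_num)
    · apply setIntegral_nonneg measurableSet_Icc
      intro x hx
      positivity
    · exact le_trans (le_trans (le_abs_self _) e2) e3
  · have hpos : 0 < ∫ x, ψ x := by
      obtain ⟨x, hx⟩ := Function.ne_iff.mp hne
      exact hc.integral_pos_of_hasCompactSupport_nonneg_nonzero hcs hnn hx
    refine ⟨1 / 4, by norm_num, (∫ x, ψ x) / 4, by positivity, 1, ?_⟩
    intro N hN s hs hsN
    have hN' : (1:ℝ) ≤ N := by exact_mod_cast hN
    have hN0 : (0:ℝ) < N := by linarith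
    rw [lt_div_iff₀ hN0] at hsN
    have hs1 : s < 1 / 4 := by nlinarith
    have hsh0 : 0 < Real.sinh s := Real.sinh_pos_iff.mpr hs
    have hsh : Real.sinh s ≤ 2 * s := by
      have h1 := Real.abs_exp_sub_one_le (x := s) (by rw [abs_of_pos hs]; linarith)
      have h2 := Real.abs_exp_sub_one_le (x := -s) (by rw [abs_neg, abs_of_pos hs]; linarith)
      rw [abs_of_pos hs] at h1
      rw [abs_neg, abs_of_pos hs] at h2
      rw [Real.sinh_eq]
      have := (abs_le.mp h1).2
      have := (abs_le.mp h2).1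
      linarith
    have e1 : (∫ l in Set.Ioi (0 : ℝ),
            ψ (l / N) * (Real.sin (l * s) / (l * Real.sinh s)) * l ^ 2)
        = ∫ l in Set.Icc (N:ℝ) (2 * N),
            ψ (l / N) * (Real.sin (l * s) / (l * Real.sinh s)) * l ^ 2 := by
      apply setIntegral_eq_of_subset_of_forall_sdiff_eq_zero measurableSet_Ioi (hsub N hN)
      intro x hx
      simp [hz N hN x hx.2]
    have e2 : (∫ l in Set.Icc (N:ℝ) (2 * N), ψ (l / N)) = N * ∫ x, ψ x := by
      rw [setIntegral_eq_integral_of_forall_compl_eq_zero (hz N hN),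
        Measure.integral_comp_div, abs_of_pos hN0, smul_eq_mul]
    have e3 : (∫ l in Set.Icc (N:ℝ) (2 * N), ψ (l / N) * ((N:ℝ) ^ 2 / 4))
        ≤ ∫ l in Set.Icc (N:ℝ) (2 * N),
            ψ (l / N) * (Real.sin (l * s) / (l * Real.sinh s)) * l ^ 2 := by
      apply setIntegral_mono_on _ _ measurableSet_Icc
      · intro l hl
        have hl0 : 0 < l := lt_of_lt_of_le hN0 hl.1
        have hls0 : 0 < l * s := by positivity
        have hls : l * s ≤ 1 / 2 := by nlinarith [hl.2]
        have hsin : l * s - (l * s) ^ 3 / 6 < Real.sin (l * s) :=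
          Real.sin_gt_sub_cube hls0
        have hcube : (l * s) ^ 3 ≤ l * s := by
          have : (l * s) ^ 2 ≤ 1 := by nlinarith
          nlinarith
        have hq : 1 / 4 ≤ Real.sin (l * s) / (l * Real.sinh s) := by
          rw [le_div_iff₀ (by positivity)]
          have : l * Real.sinh s ≤ l * (2 * s) := by gcongr
          nlinarith
        rw [mul_assoc]
        apply mul_le_mul_of_nonneg_left _ (hnn _)
        have h5 : (N:ℝ) ^ 2 ≤ l ^ 2 := by
          have := hl.1
          gcongr
        calc (N:ℝ) ^ 2 / 4 = 1 / 4 * (N:ℝ) ^ 2 := by ring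
          _ ≤ _ := by gcongr
      · apply ContinuousOn.integrableOn_compact isCompact_Icc
        fun_prop
      · apply ContinuousOn.integrableOn_compact isCompact_Icc
        have : ∀ l ∈ Set.Icc (N:ℝ) (2 * N), l * Real.sinh s ≠ 0 := by
          intro l hl
          have hl0 : 0 < l := lt_of_lt_of_le hN0 hl.1
          positivity
        fun_prop (disch := assumption)
    rw [integral_mul_const, e2] at e3
    rw [e1]
    refine le_trans ?_ (le_trans e3 (le_abs_self _))
    apply le_of_eq
    ring
end
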